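/- arXiv:1910.01326 — 2 statements merged into one kernel-verified Lean document; each statement's English description precedes it below -/
import Mathlib

section
/- Dixmier–Malliavin type factorization: let f ∈ L¹(ℝ) ∩ C^∞(ℝ) be such that every derivative f^(k) belongs to L¹(ℝ). Then there exist g ∈ L¹(ℝ) and ρ₁, ρ₂ ∈ C_c^∞(ℝ) such that f = ρ₁ ⋆ f + ρ₂ ⋆ g, where ⋆ denotes convolution. -/
open MeasureTheory

open Set Filter Topology
open scoped Convolution ContDiff NNReal

/-- A continuous kernel on the real line that vanishes outside `[0, c]`. -/
structure IsKernel (a : ℝ → ℝ) (c : ℝ) : Prop where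
  continuous : Continuous a
  eq_zero : ∀ x, x ∉ Icc 0 c → a x = 0

namespace IsKernel

variable {a b : ℝ → ℝ} {c d : ℝ}

lemma hasCompactSupport (ha : IsKernel a c) : HasCompactSupport a :=
  HasCompactSupport.intro isCompact_Icc ha.eq_zero

lemma integrable (ha : IsKernel a c) : Integrable a :=
  ha.continuous.integrable_of_hasCompactSupport ha.hasCompactSupport

lemma exists_bound (ha : IsKernel a c) : ∃ B, 0 ≤ B ∧ ∀ x, |a x| ≤ B := by
  obtain ⟨B, hB⟩ := ha.continuous.bounded_above_of_compact_support ha.hasCompactSupport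
  exact ⟨B, (norm_nonneg _).trans (hB 0), hB⟩

lemma mono (ha : IsKernel a c) (h : c ≤ d) : IsKernel a d :=
  ⟨ha.continuous, fun x hx => ha.eq_zero x fun h' => hx ⟨h'.1, h'.2.trans h⟩⟩

lemma add (ha : IsKernel a c) (hb : IsKernel b c) : IsKernel (fun x => a x + b x) c :=
  ⟨ha.continuous.add hb.continuous, fun x hx => by simp [ha.eq_zero x hx, hb.eq_zero x hx]⟩

lemma sub (ha : IsKernel a c) (hb : IsKernel b c) : IsKernel (fun x => a x - b x) c :=
  ⟨ha.continuous.sub hb.continuous, fun x hx => by simp [ha.eq_zero x hx, hb.eq_zero x hx]⟩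

lemma continuous_convolution (ha : IsKernel a c) (hb : Continuous b) :
    Continuous (a ⋆ b) :=
  ha.hasCompactSupport.continuous_convolution_left _ ha.continuous hb.locallyIntegrable

lemma convolution (ha : IsKernel a c) (hb : IsKernel b d) : IsKernel (a ⋆ b) (c + d) := by
  refine ⟨ha.continuous_convolution hb.continuous, fun x hx => ?_⟩
  by_contra h
  obtain ⟨s, hs, t, ht, rfl⟩ := support_convolution_subset _ h
  have h1 : s ∈ Icc 0 c := by
    by_contra h'
    exact hs (ha.eq_zero s h')
  have h2 : t ∈ Icc 0 d := by
    by_contra h'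
    exact ht (hb.eq_zero t h')
  exact hx ⟨add_nonneg h1.1 h2.1, add_le_add h1.2 h2.2⟩

lemma convolutionExists (ha : IsKernel a c) {f : ℝ → ℝ} (hf : Continuous f) :
    ConvolutionExists a f (ContinuousLinearMap.lsmul ℝ ℝ) :=
  ha.hasCompactSupport.convolutionExists_left_of_continuous_right _
    ha.continuous.locallyIntegrable hf

lemma integrable_mul (ha : IsKernel a c) {f : ℝ → ℝ} (hf : Continuous f) (x : ℝ) :
    Integrable fun t => a t * f (x - t) :=
  ha.convolutionExists hf x

lemma integral_abs_le (ha : IsKernel a c) (hc : 0 ≤ c) {B : ℝ} (hB : ∀ x, |a x| ≤ B) :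
    ∫ x, |a x| ≤ B * c := by
  have h : ∫ x in Icc 0 c, |a x| = ∫ x, |a x| :=
    setIntegral_eq_integral_of_forall_compl_eq_zero fun x hx => by simp [ha.eq_zero x hx]
  rw [← h]
  have := norm_setIntegral_le_of_norm_le_const (μ := volume) (s := Icc 0 c) (f := fun x => |a x|)
    (C := B) (by simp) (fun x _ => by simpa using hB x)
  simpa [hc] using (le_abs_self _).trans this

lemma abs_convolution_le (ha : IsKernel a c) {f : ℝ → ℝ} {B : ℝ}
    (hB : ∀ x, |f x| ≤ B) (x : ℝ) : |(a ⋆ f) x| ≤ (∫ t, |a t|) * B := by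
  rw [← integral_mul_const]
  refine (Real.norm_eq_abs _).symm.trans_le <| norm_integral_le_of_norm_le
      (ha.integrable.abs.mul_const B) (ae_of_all _ fun t => ?_)
  simpa [abs_mul] using mul_le_mul_of_nonneg_left (hB (x - t)) (abs_nonneg (a t))

lemma convolution_sub (ha : IsKernel a c) {f g : ℝ → ℝ} (hf : Continuous f) (hg : Continuous g)
    (x : ℝ) : (a ⋆ fun y => f y - g y) x = (a ⋆ f) x - (a ⋆ g) x := by
  simp only [convolution_lsmul, smul_eq_mul, mul_sub]
  exact integral_sub (ha.integrable_mul hf x) (ha.integrable_mul hg x)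

lemma convolution_add (ha : IsKernel a c) {f g : ℝ → ℝ} (hf : Continuous f) (hg : Continuous g)
    (x : ℝ) : (a ⋆ fun y => f y + g y) x = (a ⋆ f) x + (a ⋆ g) x := by
  simp only [convolution_lsmul, smul_eq_mul, mul_add]
  exact integral_add (ha.integrable_mul hf x) (ha.integrable_mul hg x)

lemma abs_convolution_sub_le (ha : IsKernel a c) {f : ℝ → ℝ} (hf : Continuous f) {L : ℝ}
    (hL : ∀ x y, |f x - f y| ≤ L * |x - y|) (x y : ℝ) :
    |(a ⋆ f) x - (a ⋆ f) y| ≤ (∫ t, |a t|) * L * |x - y| := by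
  have : (a ⋆ f) x - (a ⋆ f) y = ∫ t, a t * (f (x - t) - f (y - t)) := by
    simp only [convolution_lsmul, smul_eq_mul, mul_sub]
    exact (integral_sub (ha.integrable_mul hf x) (ha.integrable_mul hf y)).symm
  rw [this, mul_assoc, ← integral_mul_const]
  refine (Real.norm_eq_abs _).symm.trans_le <| norm_integral_le_of_norm_le
      (ha.integrable.abs.mul_const _) (ae_of_all _ fun t => ?_)
  have := hL (x - t) (y - t)
  rw [sub_sub_sub_cancel_right] at this
  simpa [abs_mul] using mul_le_mul_of_nonneg_left this (abs_nonneg (a t))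

lemma abs_convolution_sub_self_le (ha : IsKernel a c) {f : ℝ → ℝ} (hf : Continuous f)
    {L B : ℝ} (hL0 : 0 ≤ L) (hL : ∀ x y, |f x - f y| ≤ L * |x - y|) (hB : ∀ x, |f x| ≤ B) (x : ℝ) :
    |(a ⋆ f) x - f x| ≤ (∫ t, |a t|) * (L * c) + |(∫ t, a t) - 1| * B := by
  have h : (a ⋆ f) x - f x = (∫ t, a t * (f (x - t) - f x)) + ((∫ t, a t) - 1) * f x := by
    simp only [convolution_lsmul, smul_eq_mul, mul_sub]
    rw [integral_sub (ha.integrable_mul hf x) (ha.integrable.mul_const _), integral_mul_const]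
    ring
  rw [h]
  refine (abs_add_le _ _).trans (add_le_add ?_ ?_)
  · rw [← integral_mul_const]
    refine (Real.norm_eq_abs _).symm.trans_le <| norm_integral_le_of_norm_le
      (ha.integrable.abs.mul_const _) (ae_of_all _ fun t => ?_)
    rw [Real.norm_eq_abs, abs_mul]
    by_cases ht : t ∈ Icc 0 c
    · refine mul_le_mul_of_nonneg_left ((hL _ _).trans ?_) (abs_nonneg _)
      refine mul_le_mul_of_nonneg_left ?_ hL0
      rw [sub_sub_cancel_left, abs_neg, abs_of_nonneg ht.1]
      exact ht.2
    · simp [ha.eq_zero t ht]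
  · rw [abs_mul]
    exact mul_le_mul_of_nonneg_left (hB x) (abs_nonneg _)

lemma convolution_assoc (ha : IsKernel a c) (hb : IsKernel b d) {f : ℝ → ℝ}
    (hf : Continuous f) : (a ⋆ b) ⋆ f = a ⋆ (b ⋆ f) := by
  ext x
  have hb' : IsKernel (fun x => ‖b x‖) d :=
    ⟨hb.continuous.norm, fun x hx => by simp [hb.eq_zero x hx]⟩
  have ha' : IsKernel (fun x => ‖a x‖) c :=
    ⟨ha.continuous.norm, fun x hx => by simp [ha.eq_zero x hx]⟩
  refine MeasureTheory.convolution_assoc _ _ _ _ (fun u v w => by simp [mul_assoc])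
    ha.continuous.aestronglyMeasurable hb.continuous.aestronglyMeasurable hf.aestronglyMeasurable
    (ae_of_all _ (ha.convolutionExists hb.continuous))
    (ae_of_all _ (hb'.convolutionExists hf.norm)) ?_
  exact ha'.convolutionExists (hb'.continuous_convolution hf.norm) x

end IsKernel

lemma convolution_comm_real (a b : ℝ → ℝ) : a ⋆ b = b ⋆ a := by
  ext x
  rw [convolution_lsmul_swap]
  simp only [convolution_lsmul, smul_eq_mul, mul_comm]

/-- Convolution with a compactly supported Lipschitz kernel gains one derivative. -/
lemma IsKernel.contDiff_convolution_succ {S q : ℝ → ℝ} {c d : ℝ} {C : ℝ≥0} (hS : IsKernel S c)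
    (hC : LipschitzWith C S) (hq : IsKernel q d) {m : ℕ} (hm : ContDiff ℝ m q) :
    ContDiff ℝ (m + 1) (S ⋆ q) := by
  have hcS : HasCompactSupport (deriv S) := hS.hasCompactSupport.deriv
  have hbd : ∀ x, ‖deriv S x‖ ≤ C := fun x => norm_deriv_le_of_lipschitz hC
  have hint : Integrable (deriv S) := by
    have : IntegrableOn (deriv S) (Icc 0 c) :=
      Measure.integrableOn_of_bounded (M := C) (by simp)
        (measurable_deriv S).aestronglyMeasurable (ae_of_all _ hbd)
    refine (integrableOn_iff_integrable_of_support_subset ?_).1 this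
    refine (support_deriv_subset).trans (closure_minimal (fun x hx => ?_) isClosed_Icc)
    by_contra h
    exact hx (hS.eq_zero x h)
  have hd : ∀ x, HasDerivAt (S ⋆ q) ((deriv S ⋆ q) x) x := by
    intro x
    rw [convolution_comm_real S q, convolution_comm_real (deriv S) q]
    have hdiff : ∀ᵐ t : ℝ, HasDerivAt (fun y => q t * S (y - t)) (q t * deriv S (x - t)) x := by
      have h1 : ∀ᵐ s : ℝ, DifferentiableAt ℝ S s := hC.ae_differentiableAt_real
      have h2 := (quasiMeasurePreserving_sub_left_of_right_invariant volume x).ae h1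
      filter_upwards [h2] with t ht
      exact (ht.hasDerivAt.comp_sub_const x t).const_mul (q t)
    refine (hasDerivAt_integral_of_dominated_loc_of_lip (s := univ)
      (bound := fun t => |q t| * C) univ_mem ?_ ?_ ?_ ?_ ?_ hdiff).2
    · refine Eventually.of_forall fun y => ?_
      exact (hq.integrable_mul hS.continuous y).aestronglyMeasurable
    · exact hq.integrable_mul hS.continuous x
    · exact hq.continuous.aestronglyMeasurable.mul
        ((measurable_deriv S).comp (measurable_const.sub measurable_id)).aestronglyMeasurable
    · refine ae_of_all _ fun t => LipschitzOnWith.of_dist_le_mul fun y _ z _ => ?_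
      have := hC.dist_le_mul (y - t) (z - t)
      simp only [Real.dist_eq, sub_sub_sub_cancel_right] at this ⊢
      rw [← mul_sub, abs_mul, Real.coe_nnabs, abs_mul, abs_abs, NNReal.abs_eq, mul_assoc]
      exact mul_le_mul_of_nonneg_left this (abs_nonneg _)
    · exact hq.integrable.abs.mul_const _
  rw [contDiff_succ_iff_deriv]
  refine ⟨fun x => (hd x).differentiableAt, by simp, ?_⟩
  rw [funext fun x => (hd x).deriv]
  exact hq.hasCompactSupport.contDiff_convolution_right _ hint.locallyIntegrable
    (n := (m : ℕ∞)) hm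

/-- Multiplying a smooth function supported in `[a, b]`, `0 < a`, by `exp (-l * t)` makes every
derivative small as `l → ∞`, even after multiplication with powers of `l`. -/
lemma eventually_iteratedDeriv_mul_exp_le {a b : ℝ} (ha : 0 < a) (i : ℕ) :
    ∀ (w : ℝ → ℝ), ContDiff ℝ ∞ w → (∀ t, t ∉ Icc a b → w t = 0) → ∀ (k : ℕ) (η : ℝ), 0 < η →
      ∀ᶠ l : ℝ in atTop, ∀ x,
        l ^ k * |iteratedDeriv i (fun t => w t * Real.exp (-l * t)) x| ≤ η := by
  induction i with
  | zero =>
    intro w hw hs k η hη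
    obtain ⟨B, hB⟩ := hw.continuous.bounded_above_of_compact_support
      (HasCompactSupport.intro isCompact_Icc hs)
    have hB0 : 0 ≤ B := (norm_nonneg _).trans (hB 0)
    have h1 : Tendsto (fun l : ℝ => l ^ k * Real.exp (-a * l) * B) atTop (𝓝 0) := by
      have := (tendsto_rpow_mul_exp_neg_mul_atTop_nhds_zero k a ha).mul_const B
      simpa using this
    filter_upwards [h1.eventually_le_const hη, eventually_ge_atTop 0] with l hl hl0 x
    refine le_trans ?_ hl
    rw [iteratedDeriv_zero, abs_mul, Real.abs_exp, mul_assoc]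
    refine mul_le_mul_of_nonneg_left ?_ (by positivity)
    rw [mul_comm]
    by_cases hx : x ∈ Icc a b
    · refine mul_le_mul (Real.exp_le_exp.2 ?_) (hB x) (abs_nonneg _) (Real.exp_nonneg _)
      nlinarith [hx.1]
    · simp only [hs x hx, abs_zero, mul_zero]
      positivity
  | succ i ih =>
    intro w hw hs k η hη
    have hw' : ContDiff ℝ ∞ (deriv w) := (contDiff_infty_iff_deriv.1 hw).2
    have hs' : ∀ t, t ∉ Icc a b → deriv w t = 0 := fun t ht => by
      have : w =ᶠ[𝓝 t] fun _ => 0 := by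
        filter_upwards [isClosed_Icc.isOpen_compl.mem_nhds ht] with s h using hs s h
      rw [this.deriv_eq, deriv_const]
    filter_upwards [ih (deriv w) hw' hs' k (η / 2) (by positivity),
      ih w hw hs (k + 1) (η / 2) (by positivity), eventually_ge_atTop 0] with l h1 h2 hl0 x
    have hE : ContDiff ℝ ∞ fun t : ℝ => Real.exp (-l * t) := by fun_prop
    have hd : deriv (fun t => w t * Real.exp (-l * t)) =
        (fun t => deriv w t * Real.exp (-l * t)) - fun t => l * (w t * Real.exp (-l * t)) := by
      ext t
      have h3 : HasDerivAt w (deriv w t) t :=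
        ((contDiff_infty_iff_deriv.1 hw).1 t).hasDerivAt
      have h4 : HasDerivAt (fun t : ℝ => Real.exp (-l * t)) (Real.exp (-l * t) * (-l * 1)) t :=
        ((hasDerivAt_id t).const_mul (-l)).exp
      rw [(h3.fun_mul h4).deriv]
      simp only [Pi.sub_apply]
      ring
    have hle : ((i : ℕ∞) : WithTop ℕ∞) ≤ ∞ := by exact_mod_cast le_top
    rw [iteratedDeriv_succ', hd, iteratedDeriv_sub ((hw'.mul hE).of_le hle).contDiffAt
      ((contDiff_const.mul (hw.mul hE)).of_le hle).contDiffAt, iteratedDeriv_const_mul_field]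
    have h5 := h1 x
    have h6 := h2 x
    calc _ ≤ l ^ k * (|iteratedDeriv i (fun t => deriv w t * Real.exp (-l * t)) x| +
          |l * iteratedDeriv i (fun t => w t * Real.exp (-l * t)) x|) :=
          mul_le_mul_of_nonneg_left (abs_sub _ _) (by positivity)
      _ ≤ η := by
          rw [abs_mul, abs_of_nonneg hl0]
          rw [pow_succ] at h6
          linarith

/-- Integration by parts against the fundamental solution of `(1 + l⁻¹ d/dt)²`. -/
lemma integral_mul_exp_by_parts {ψ φ : ℝ → ℝ} {ε l : ℝ} (hψ : ContDiff ℝ 2 ψ)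
    (hφ : ContDiff ℝ 2 φ) (h0 : ψ 0 = 0) (h0' : deriv ψ 0 = 1) (hε : ψ ε = 0)
    (hε' : deriv ψ ε = 0) (hl : l ≠ 0) (x : ℝ) :
    ∫ t in 0..ε, l ^ 2 * ψ t * Real.exp (-l * t) *
      (φ (x - t) + 2 * l⁻¹ * deriv φ (x - t) + l⁻¹ ^ 2 * deriv (deriv φ) (x - t)) =
    φ x + ∫ t in 0..ε, deriv (deriv ψ) t * Real.exp (-l * t) * φ (x - t) := by
  have key : ∀ φ : ℝ → ℝ, ContDiff ℝ 2 φ → ContDiff ℝ 1 (deriv φ) ∧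
      (∀ t, HasDerivAt φ (deriv φ t) t) ∧ (∀ t, HasDerivAt (deriv φ) (deriv (deriv φ) t) t) ∧
      Continuous (deriv (deriv φ)) := by
    intro φ hφ
    have h1 : ContDiff ℝ 1 (deriv φ) := by
      have := (contDiff_succ_iff_deriv (n := 1)).1 (by simpa [one_add_one_eq_two] using hφ)
      exact this.2.2
    exact ⟨h1, fun t => (hφ.differentiable (by norm_num) t).hasDerivAt,
      fun t => (h1.differentiable (by norm_num) t).hasDerivAt, h1.continuous_deriv le_rfl⟩
  obtain ⟨hψ1, hψd, hψdd, hψc⟩ := key ψ hψ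
  obtain ⟨hφ1, hφd, hφdd, hφc⟩ := key φ hφ
  have c1 := hψ.continuous
  have c2 := hφ.continuous
  have c3 := hψ1.continuous
  have c4 := hφ1.continuous
  have hd : ∀ t, HasDerivAt (fun t => Real.exp (-l * t) *
      (ψ t * (-l * φ (x - t) - deriv φ (x - t)) - deriv ψ t * φ (x - t)))
      (l ^ 2 * ψ t * Real.exp (-l * t) *
      (φ (x - t) + 2 * l⁻¹ * deriv φ (x - t) + l⁻¹ ^ 2 * deriv (deriv φ) (x - t)) -
      deriv (deriv ψ) t * Real.exp (-l * t) * φ (x - t)) t := by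
    intro t
    have e : HasDerivAt (fun t : ℝ => Real.exp (-l * t)) (Real.exp (-l * t) * (-l * 1)) t :=
      ((hasDerivAt_id t).const_mul (-l)).exp
    have p : HasDerivAt (fun t => φ (x - t)) (-deriv φ (x - t)) t :=
      (hφd (x - t)).comp_const_sub x t
    have p' : HasDerivAt (fun t => deriv φ (x - t)) (-deriv (deriv φ) (x - t)) t :=
      (hφdd (x - t)).comp_const_sub x t
    refine (e.fun_mul (((hψd t).fun_mul ((p.const_mul (-l)).fun_sub p')).fun_sub
      ((hψdd t).fun_mul p))).congr_deriv ?_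
    field_simp
    ring
  have i1 : IntervalIntegrable (fun t => l ^ 2 * ψ t * Real.exp (-l * t) *
      (φ (x - t) + 2 * l⁻¹ * deriv φ (x - t) + l⁻¹ ^ 2 * deriv (deriv φ) (x - t)))
      volume 0 ε := by
    apply Continuous.intervalIntegrable
    fun_prop
  have i2 : IntervalIntegrable (fun t => deriv (deriv ψ) t * Real.exp (-l * t) * φ (x - t))
      volume 0 ε := by
    apply Continuous.intervalIntegrable
    fun_prop
  have := intervalIntegral.integral_eq_sub_of_hasDerivAt (fun t _ => hd t) (i1.sub i2)
  rw [intervalIntegral.integral_sub i1 i2] at this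
  simp only [h0, h0', hε, hε', mul_zero, Real.exp_zero, sub_zero] at this
  linarith

lemma IsKernel.convolution_eq_intervalIntegral {a f : ℝ → ℝ} {c : ℝ} (ha : IsKernel a c)
    (hc : 0 ≤ c) (x : ℝ) : (a ⋆ f) x = ∫ t in 0..c, a t * f (x - t) := by
  rw [intervalIntegral.integral_of_le hc, ← integral_Icc_eq_integral_Ioc, convolution_lsmul]
  exact (setIntegral_eq_integral_of_forall_compl_eq_zero fun t ht => by
    simp [ha.eq_zero t ht]).symm

/-- A cut-off version of the identity function. -/
lemma exists_smooth_cutoff_id {ε : ℝ} (hε : 0 < ε) :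
    ∃ ψ : ℝ → ℝ, ContDiff ℝ ∞ ψ ∧ (∀ t, t < ε / 2 → ψ t = t) ∧ (∀ t, ε ≤ t → ψ t = 0) ∧
      ∀ t, 0 ≤ t → 0 ≤ ψ t := by
  refine ⟨fun t => t * Real.smoothTransition (2 - 2 / ε * t), ?_, fun t ht => ?_, fun t ht => ?_,
    fun t ht => mul_nonneg ht (Real.smoothTransition.nonneg _)⟩
  · exact contDiff_id.mul (Real.smoothTransition.contDiff.comp (by fun_prop))
  · have : 2 / ε * t ≤ 1 := by
      rw [div_mul_eq_mul_div, div_le_one hε]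
      linarith
    simp [Real.smoothTransition.one_of_one_le (x := 2 - 2 / ε * t) (by linarith)]
  · have : 2 ≤ 2 / ε * t := by
      rw [div_mul_eq_mul_div, le_div_iff₀ hε]
      linarith
    simp [Real.smoothTransition.zero_of_nonpos (x := 2 - 2 / ε * t) (by linarith)]

/-- For small `c`, the operator `(1 + c d/dx)²` has a fundamental solution, supported in `[0, ε]`,
modulo a small smooth error. -/
lemma exists_kernel_parametrix {ε η δ : ℝ} (hε : 0 < ε) (hη : 0 < η) (hδ : 0 < δ) (m : ℕ) :
    ∃ (c : ℝ) (S r : ℝ → ℝ), 0 ≤ c ∧ c ≤ δ ∧ IsKernel S ε ∧ (∃ C : ℝ≥0, LipschitzWith C S) ∧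
      (∀ x, 0 ≤ S x) ∧ IsKernel r ε ∧ ContDiff ℝ ∞ r ∧
      (∀ i ≤ m, ∀ x, |iteratedDeriv i r x| ≤ η) ∧
      ∀ φ : ℝ → ℝ, ContDiff ℝ 2 φ → ∀ x, φ x =
        (S ⋆ fun y => φ y + 2 * c * deriv φ y + c ^ 2 * deriv (deriv φ) y) x + (r ⋆ φ) x := by
  obtain ⟨ψ, hψ, hψ1, hψ2, hψ3⟩ := exists_smooth_cutoff_id hε
  have hψ' : ContDiff ℝ ∞ (deriv ψ) := (contDiff_infty_iff_deriv.1 hψ).2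
  have hw : ContDiff ℝ ∞ (deriv (deriv ψ)) := (contDiff_infty_iff_deriv.1 hψ').2
  have hleft : ∀ t, t < ε / 2 → deriv ψ t = 1 := fun t ht => by
    have : ψ =ᶠ[𝓝 t] id := by
      filter_upwards [Iio_mem_nhds ht] with s hs using hψ1 s hs
    rw [this.deriv_eq, deriv_id]
  have hright : ∀ t, ε < t → deriv ψ t = 0 := fun t ht => by
    have : ψ =ᶠ[𝓝 t] fun _ => 0 := by
      filter_upwards [Ioi_mem_nhds ht] with s hs using hψ2 s hs.le
    rw [this.deriv_eq, deriv_const]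
  have hrightε : deriv ψ ε = 0 := by
    have h1 : Tendsto (deriv ψ) (𝓝[>] ε) (𝓝 (deriv ψ ε)) :=
      (hψ'.continuous.tendsto ε).mono_left nhdsWithin_le_nhds
    refine tendsto_nhds_unique h1 (tendsto_const_nhds.congr' ?_)
    filter_upwards [self_mem_nhdsWithin] with s hs using (hright s hs).symm
  have hws : ∀ t, t ∉ Icc (ε / 2) ε → deriv (deriv ψ) t = 0 := fun t ht => by
    rw [mem_Icc, not_and_or, not_le, not_le] at ht
    rcases ht with ht | ht
    · have : deriv ψ =ᶠ[𝓝 t] fun _ => 1 := by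
        filter_upwards [Iio_mem_nhds ht] with s hs using hleft s hs
      rw [this.deriv_eq, deriv_const]
    · have : deriv ψ =ᶠ[𝓝 t] fun _ => 0 := by
        filter_upwards [Ioi_mem_nhds ht] with s hs using hright s hs
      rw [this.deriv_eq, deriv_const]
  have hsmall : ∀ᶠ l : ℝ in atTop, ∀ i ∈ Finset.range (m + 1), ∀ x,
      |iteratedDeriv i (fun t => -deriv (deriv ψ) t * Real.exp (-l * t)) x| ≤ η := by
    rw [Filter.eventually_all_finset]
    intro i _
    simpa using eventually_iteratedDeriv_mul_exp_le (b := ε) (half_pos hε) i _ hw.neg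
      (fun t ht => by simp [hws t ht]) 0 η hη
  obtain ⟨l, hl, hl0, hlδ⟩ := (hsmall.and ((eventually_gt_atTop 0).and
    (eventually_ge_atTop δ⁻¹))).exists
  set G : ℝ → ℝ := fun t => l ^ 2 * ψ t * Real.exp (-l * t) with hG
  have hGc : ContDiff ℝ ∞ G := by
    have : ContDiff ℝ ∞ fun t : ℝ => Real.exp (-l * t) := by fun_prop
    exact (contDiff_const.mul hψ).mul this
  have hψ0 : ψ 0 = 0 := hψ1 0 (by positivity)
  have hG0 : G 0 = 0 := by simp [hG, hψ0]
  have hGε : G ε = 0 := by simp [hG, hψ2 ε le_rfl]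
  set S : ℝ → ℝ := fun t => G (projIcc 0 ε hε.le t) with hS
  have hSG : ∀ t ∈ Icc 0 ε, S t = G t := fun t ht => by
    simp [hS, projIcc_of_mem hε.le ht]
  have hLip : ∃ C : ℝ≥0, LipschitzWith C S := by
    obtain ⟨K, hK⟩ := (hGc.of_le (by norm_num : (1 : WithTop ℕ∞) ≤ ∞)).locallyLipschitz
      |>.locallyLipschitzOn.exists_lipschitzOnWith_of_compact (isCompact_Icc (a := 0) (b := ε))
    exact ⟨K, by
      simpa using! (lipschitzOnWith_iff_restrict.1 hK).comp (LipschitzWith.projIcc hε.le)⟩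
  have hSker : IsKernel S ε := by
    refine ⟨hLip.choose_spec.continuous, fun t ht => ?_⟩
    rw [mem_Icc, not_and_or, not_le, not_le] at ht
    rcases ht with ht | ht
    · simp [hS, projIcc_of_le_left hε.le ht.le, hG0]
    · simp [hS, projIcc_of_right_le hε.le ht.le, hGε]
  have hrc : ContDiff ℝ ∞ fun t => -deriv (deriv ψ) t * Real.exp (-l * t) := by
    have : ContDiff ℝ ∞ fun t : ℝ => Real.exp (-l * t) := by fun_prop
    exact hw.neg.mul this
  have hrker : IsKernel (fun t => -deriv (deriv ψ) t * Real.exp (-l * t)) ε :=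
    ⟨hrc.continuous, fun t ht => by
      simp [hws t fun h => ht ⟨(half_pos hε).le.trans h.1, h.2⟩]⟩
  refine ⟨l⁻¹, S, fun t => -deriv (deriv ψ) t * Real.exp (-l * t), by positivity,
    inv_le_of_inv_le₀ hδ hlδ, hSker, hLip, fun t => ?_, hrker, hrc,
    fun i hi => hl i (by simpa using Nat.lt_succ_of_le hi), fun φ hφ x => ?_⟩
  · have := hψ3 _ (projIcc 0 ε hε.le t).2.1
    simp only [hS, hG]
    positivity
  · have key := integral_mul_exp_by_parts (contDiff_infty.1 hψ 2) hφ hψ0 (hleft 0 (by positivity))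
      (hψ2 ε le_rfl) hrightε hl0.ne' x
    rw [hSker.convolution_eq_intervalIntegral hε.le, hrker.convolution_eq_intervalIntegral hε.le]
    have e1 : ∫ t in 0..ε, S t * (φ (x - t) + 2 * l⁻¹ * deriv φ (x - t) +
        l⁻¹ ^ 2 * deriv (deriv φ) (x - t)) = ∫ t in 0..ε, G t * (φ (x - t) +
        2 * l⁻¹ * deriv φ (x - t) + l⁻¹ ^ 2 * deriv (deriv φ) (x - t)) :=
      intervalIntegral.integral_congr fun t ht => by
        rw [uIcc_of_le hε.le] at ht
        simp only [hSG t ht]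
    rw [e1, key]
    simp only [neg_mul, intervalIntegral.integral_neg]
    ring

/-- The differential operator `(1 + c d/dx)²`. -/
noncomputable def sqOnePlusDeriv (c : ℝ) (φ : ℝ → ℝ) : ℝ → ℝ :=
  fun y => φ y + 2 * c * deriv φ y + c ^ 2 * deriv (deriv φ) y

lemma ContDiff.sqOnePlusDeriv {φ : ℝ → ℝ} (hφ : ContDiff ℝ ∞ φ) (c : ℝ) :
    ContDiff ℝ ∞ (sqOnePlusDeriv c φ) := by
  have h1 := (contDiff_infty_iff_deriv.1 hφ).2
  have h2 := (contDiff_infty_iff_deriv.1 h1).2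
  exact (hφ.add (contDiff_const.mul h1)).add (contDiff_const.mul h2)

lemma iteratedDeriv_sqOnePlusDeriv {φ : ℝ → ℝ} (hφ : ContDiff ℝ ∞ φ) (c : ℝ) (m : ℕ) :
    iteratedDeriv m (sqOnePlusDeriv c φ) = fun y => iteratedDeriv m φ y +
      2 * c * iteratedDeriv (m + 1) φ y + c ^ 2 * iteratedDeriv (m + 2) φ y := by
  have h1 := (contDiff_infty_iff_deriv.1 hφ).2
  have h2 := (contDiff_infty_iff_deriv.1 h1).2
  ext y
  have e0 : ContDiffAt ℝ m φ y := (contDiff_infty.1 hφ m).contDiffAt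
  have e1 : ContDiffAt ℝ m (fun y => 2 * c * deriv φ y) y :=
    (contDiff_infty.1 (contDiff_const.mul h1) m).contDiffAt
  have e2 : ContDiffAt ℝ m (fun y => c ^ 2 * deriv (deriv φ) y) y :=
    (contDiff_infty.1 (contDiff_const.mul h2) m).contDiffAt
  unfold sqOnePlusDeriv
  rw [iteratedDeriv_fun_add (e0.add e1) e2, iteratedDeriv_fun_add e0 e1,
    iteratedDeriv_const_mul_field, iteratedDeriv_const_mul_field]
  simp only [iteratedDeriv_succ']

/-- Successive application of the operators `(1 + c n d/dx)²`. -/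
noncomputable def iterSqOnePlusDeriv (c : ℕ → ℝ) (f : ℝ → ℝ) : ℕ → ℝ → ℝ
  | 0 => f
  | n + 1 => sqOnePlusDeriv (c n) (iterSqOnePlusDeriv c f n)

section iterSqOnePlusDeriv

variable {c : ℕ → ℝ} {f : ℝ → ℝ}

lemma contDiff_iterSqOnePlusDeriv (hf : ContDiff ℝ ∞ f) (n : ℕ) :
    ContDiff ℝ ∞ (iterSqOnePlusDeriv c f n) := by
  induction n with
  | zero => exact hf
  | succ n ih => exact ih.sqOnePlusDeriv _

lemma integrable_iteratedDeriv_iterSqOnePlusDeriv (hf : ContDiff ℝ ∞ f)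
    (hint : ∀ k, Integrable (iteratedDeriv k f)) (n m : ℕ) :
    Integrable (iteratedDeriv m (iterSqOnePlusDeriv c f n)) := by
  induction n generalizing m with
  | zero => exact hint m
  | succ n ih =>
    rw [iterSqOnePlusDeriv, iteratedDeriv_sqOnePlusDeriv (contDiff_iterSqOnePlusDeriv hf n)]
    exact ((ih m).add ((ih (m + 1)).const_mul _)).add ((ih (m + 2)).const_mul _)

lemma integral_abs_add_mul_add_mul_le {u v w : ℝ → ℝ} {p q : ℝ} (hu : Integrable u)
    (hv : Integrable v) (hw : Integrable w) (hp : 0 ≤ p) (hq : 0 ≤ q) :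
    ∫ x, |u x + p * v x + q * w x| ≤ (∫ x, |u x|) + p * (∫ x, |v x|) + q * ∫ x, |w x| := by
  have hI : Integrable fun x => |u x| + p * |v x| := hu.abs.add (hv.abs.const_mul p)
  rw [← integral_const_mul, ← integral_const_mul,
    ← integral_add hu.abs (hv.abs.const_mul p), ← integral_add hI (hw.abs.const_mul q)]
  refine integral_mono ((hu.add (hv.const_mul p)).add (hw.const_mul q)).abs
    (hI.add (hw.abs.const_mul q)) fun x => ?_
  refine (abs_add_le _ _).trans (add_le_add ((abs_add_le _ _).trans ?_) ?_)
  · simp [abs_mul, abs_of_nonneg hp]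
  · simp [abs_mul, abs_of_nonneg hq]

lemma integral_abs_iteratedDeriv_iterSqOnePlusDeriv_le (hf : ContDiff ℝ ∞ f)
    (hint : ∀ k, Integrable (iteratedDeriv k f)) (hc0 : ∀ n, 0 ≤ c n) (hc1 : ∀ n, c n ≤ 1)
    (n m : ℕ) : ∫ x, |iteratedDeriv m (iterSqOnePlusDeriv c f n) x| ≤
      4 ^ n * ∑ k ∈ Finset.range (m + 2 * n + 1), ∫ x, |iteratedDeriv k f x| := by
  have hnn : ∀ k, 0 ≤ ∫ x, |iteratedDeriv k f x| := fun k => integral_nonneg fun _ => abs_nonneg _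
  induction n generalizing m with
  | zero =>
    simpa [iterSqOnePlusDeriv] using Finset.single_le_sum (f := fun k => ∫ x, |iteratedDeriv k f x|)
      (fun k _ => hnn k) (Finset.self_mem_range_succ m)
  | succ n ih =>
    have hi := integrable_iteratedDeriv_iterSqOnePlusDeriv (c := c) hf hint n
    rw [iterSqOnePlusDeriv, iteratedDeriv_sqOnePlusDeriv (contDiff_iterSqOnePlusDeriv hf n)]
    have hmono : ∀ j ≤ m + 2, ∫ x, |iteratedDeriv j (iterSqOnePlusDeriv c f n) x| ≤
        4 ^ n * ∑ k ∈ Finset.range (m + 2 * (n + 1) + 1), ∫ x, |iteratedDeriv k f x| := by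
      intro j hj
      refine (ih j).trans (mul_le_mul_of_nonneg_left ?_ (by positivity))
      exact Finset.sum_le_sum_of_subset_of_nonneg (Finset.range_subset_range.2 (by omega))
        fun k _ _ => hnn k
    have h0 := hmono m (by omega)
    have h1 := hmono (m + 1) (by omega)
    have h2 := hmono (m + 2) (by omega)
    have hb0 : 0 ≤ 4 ^ n * ∑ k ∈ Finset.range (m + 2 * (n + 1) + 1), ∫ x, |iteratedDeriv k f x| :=
      (integral_nonneg fun _ => abs_nonneg _).trans h0
    refine (integral_abs_add_mul_add_mul_le (hi m) (hi (m + 1)) (hi (m + 2))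
      (mul_nonneg zero_le_two (hc0 n)) (sq_nonneg _)).trans ?_
    have h3 := mul_le_mul (by linarith [hc1 n] : 2 * c n ≤ 2) h1
      (integral_nonneg fun _ => abs_nonneg _) zero_le_two
    have h4 := mul_le_mul (pow_le_one₀ (hc0 n) (hc1 n) : c n ^ 2 ≤ 1) h2
      (integral_nonneg fun _ => abs_nonneg _) zero_le_one
    rw [pow_succ (4 : ℝ) n]
    linarith

lemma integral_abs_iterSqOnePlusDeriv_succ_sub_le (hf : ContDiff ℝ ∞ f)
    (hint : ∀ k, Integrable (iteratedDeriv k f)) (hc0 : ∀ n, 0 ≤ c n) (hc1 : ∀ n, c n ≤ 1)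
    (n : ℕ) : ∫ x, |iterSqOnePlusDeriv c f (n + 1) x - iterSqOnePlusDeriv c f n x| ≤
      c n * (3 * 4 ^ n * ∑ k ∈ Finset.range (2 + 2 * n + 1), ∫ x, |iteratedDeriv k f x|) := by
  have hnn : ∀ k, 0 ≤ ∫ x, |iteratedDeriv k f x| := fun k => integral_nonneg fun _ => abs_nonneg _
  have hi := integrable_iteratedDeriv_iterSqOnePlusDeriv (c := c) hf hint n
  have h := integral_abs_iteratedDeriv_iterSqOnePlusDeriv_le hf hint hc0 hc1 n
  have h1 : ∫ x, |iteratedDeriv 1 (iterSqOnePlusDeriv c f n) x| ≤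
      4 ^ n * ∑ k ∈ Finset.range (2 + 2 * n + 1), ∫ x, |iteratedDeriv k f x| := by
    refine (h 1).trans (mul_le_mul_of_nonneg_left ?_ (by positivity))
    exact Finset.sum_le_sum_of_subset_of_nonneg (Finset.range_subset_range.2 (by omega))
      fun k _ _ => hnn k
  have h2 := h 2
  have key := integral_abs_add_mul_add_mul_le (u := fun _ => 0) (p := 2 * c n) (q := c n ^ 2)
    (integrable_zero _ _ _) (hi 1) (hi 2) (mul_nonneg zero_le_two (hc0 n)) (sq_nonneg _)
  have e : ∀ x, iterSqOnePlusDeriv c f (n + 1) x - iterSqOnePlusDeriv c f n x =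
      0 + 2 * c n * iteratedDeriv 1 (iterSqOnePlusDeriv c f n) x +
        c n ^ 2 * iteratedDeriv 2 (iterSqOnePlusDeriv c f n) x := by
    intro x
    simp only [iterSqOnePlusDeriv, sqOnePlusDeriv, iteratedDeriv_succ', iteratedDeriv_zero]
    ring
  simp only [e]
  refine key.trans ?_
  have h3 := mul_le_mul_of_nonneg_left h1 (mul_nonneg zero_le_two (hc0 n))
  have h4 := mul_le_mul (by nlinarith [hc0 n, hc1 n] : c n ^ 2 ≤ c n) h2
    (integral_nonneg fun _ => abs_nonneg _) (hc0 n)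
  simp only [abs_zero, integral_zero]
  linarith

end iterSqOnePlusDeriv

/-- A sequence in `L¹` whose consecutive distances are geometrically small converges. -/
lemma exists_integrable_tendsto_of_geometric {u : ℕ → ℝ → ℝ} (hu : ∀ n, Integrable (u n)) {K : ℝ}
    (h : ∀ n, ∫ x, |u (n + 1) x - u n x| ≤ K * (1 / 2) ^ n) :
    ∃ g : ℝ → ℝ, Integrable g ∧ Tendsto (fun n => ∫ x, |u n x - g x|) atTop (𝓝 0) := by
  have hdist : ∀ n, dist ((hu n).toL1 (u n)) ((hu (n + 1)).toL1 (u (n + 1))) ≤ K * (1 / 2) ^ n := by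
    intro n
    rw [dist_comm, dist_eq_norm, ← Integrable.toL1_sub, L1.norm_of_fun_eq_integral_norm]
    exact h n
  obtain ⟨g, hg⟩ := cauchySeq_tendsto_of_complete
    (cauchySeq_of_le_geometric (1 / 2) K (by norm_num) hdist)
  refine ⟨g, L1.integrable_coeFn g, ?_⟩
  refine (tendsto_iff_dist_tendsto_zero.1 hg).congr fun n => ?_
  rw [dist_eq_norm, L1.norm_eq_integral_norm]
  refine integral_congr_ae ?_
  filter_upwards [Lp.coeFn_sub ((hu n).toL1 (u n)) g, (hu n).coeFn_toL1] with x h1 h2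
  rw [h1, Pi.sub_apply, h2, Real.norm_eq_abs]

lemma tendsto_const_mul_one_half_pow (K : ℝ) :
    Tendsto (fun n : ℕ => K * (1 / 2 : ℝ) ^ n) atTop (𝓝 0) := by
  simpa using (tendsto_pow_atTop_nhds_zero_of_lt_one (r := (1 / 2 : ℝ)) (by norm_num)
    (by norm_num)).const_mul K

lemma tendsto_of_abs_sub_le_one_half_pow {u : ℕ → ℝ} {a K : ℝ}
    (h : ∀ n, |u n - a| ≤ K * (1 / 2) ^ n) : Tendsto u atTop (𝓝 a) :=
  tendsto_iff_dist_tendsto_zero.2 <| squeeze_zero (fun _ => dist_nonneg)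
    (fun n => (Real.dist_eq _ _).trans_le (h n)) (tendsto_const_mul_one_half_pow K)

/-- A sequence of kernels whose consecutive uniform distances are geometrically small converges. -/
lemma exists_isKernel_limit {F : ℕ → ℝ → ℝ} {c K : ℝ} (hF : ∀ n, IsKernel (F n) c)
    (h : ∀ n x, |F n x - F (n + 1) x| ≤ K * (1 / 2) ^ n) :
    ∃ ρ, IsKernel ρ c ∧ ∀ n x, |F n x - ρ x| ≤ 2 * K * (1 / 2) ^ n := by
  have hd : ∀ x n, dist (F n x) (F (n + 1) x) ≤ K * (1 / 2) ^ n := fun x n => h n x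
  choose ρ hρ using fun x => cauchySeq_tendsto_of_complete
    (cauchySeq_of_le_geometric (1 / 2) K (by norm_num) (hd x))
  have hb : ∀ n x, |F n x - ρ x| ≤ 2 * K * (1 / 2) ^ n := by
    intro n x
    refine (dist_le_of_le_geometric_of_tendsto (1 / 2) K (by norm_num) (hd x) (hρ x) n).trans_eq ?_
    ring
  refine ⟨ρ, ⟨?_, fun x hx => ?_⟩, hb⟩
  · have hu : TendstoUniformly F ρ atTop := by
      rw [Metric.tendstoUniformly_iff]
      intro e he
      filter_upwards [(tendsto_const_mul_one_half_pow (2 * K)).eventually (gt_mem_nhds he)]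
        with n hn x
      rw [dist_comm]
      exact (hb n x).trans_lt hn
    exact hu.continuous (Frequently.of_forall fun n => (hF n).continuous)
  · refine tendsto_nhds_unique (hρ x) ?_
    simp [(hF _).eq_zero x hx]

/-- Convolutions are jointly continuous for uniform convergence of kernels and `L¹` convergence. -/
lemma tendsto_convolution {P : ℕ → ℝ → ℝ} {ρ : ℝ → ℝ} {u : ℕ → ℝ → ℝ} {v : ℝ → ℝ} {c K : ℝ}
    (hP : ∀ n, IsKernel (P n) c) (hρ : IsKernel ρ c)
    (h : ∀ n x, |P n x - ρ x| ≤ K * (1 / 2) ^ n) (hu : ∀ n, Integrable (u n)) (hv : Integrable v)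
    (huv : Tendsto (fun n => ∫ x, |u n x - v x|) atTop (𝓝 0)) (x : ℝ) :
    Tendsto (fun n => ∫ t, P n (x - t) * u n t) atTop (𝓝 (∫ t, ρ (x - t) * v t)) := by
  obtain ⟨B, hB0, hB⟩ := hρ.exists_bound
  have hK : 0 ≤ K := by simpa using (abs_nonneg _).trans (h 0 0)
  have hmul : ∀ {a w : ℝ → ℝ}, IsKernel a c → Integrable w →
      Integrable fun t => a (x - t) * w t := by
    intro a w ha hw
    obtain ⟨A, -, hA⟩ := ha.exists_bound
    exact hw.bdd_mul (c := A) (ha.continuous.comp (continuous_const.sub continuous_id)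
      |>.aestronglyMeasurable) (ae_of_all _ fun t => hA _)
  have hbound : ∀ n, |(∫ t, P n (x - t) * u n t) - ∫ t, ρ (x - t) * v t| ≤
      (K + B) * (∫ t, |u n t - v t|) + K * (1 / 2) ^ n * ∫ t, |v t| := by
    intro n
    have hw : Integrable fun t => |u n t - v t| := ((hu n).sub hv).abs
    rw [← integral_sub (hmul (hP n) (hu n)) (hmul hρ hv), ← integral_const_mul,
      ← integral_const_mul, ← integral_add (hw.const_mul _) (hv.abs.const_mul _)]
    refine (Real.norm_eq_abs _).symm.trans_le <| norm_integral_le_of_norm_le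
      ((hw.const_mul _).add (hv.abs.const_mul _)) (ae_of_all _ fun t => ?_)
    have e : P n (x - t) * u n t - ρ (x - t) * v t =
        (P n (x - t) - ρ (x - t) + ρ (x - t)) * (u n t - v t) +
          (P n (x - t) - ρ (x - t)) * v t := by ring
    have h1 : |P n (x - t) - ρ (x - t)| ≤ K := (h n _).trans <|
      mul_le_of_le_one_right hK (pow_le_one₀ (by norm_num) (by norm_num))
    rw [Real.norm_eq_abs, e]
    refine (abs_add_le _ _).trans (add_le_add ?_ ?_)
    · rw [abs_mul]
      exact mul_le_mul_of_nonneg_right ((abs_add_le _ _).trans (add_le_add h1 (hB _)))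
        (abs_nonneg _)
    · rw [abs_mul]
      exact mul_le_mul_of_nonneg_right (h n _) (abs_nonneg _)
  refine tendsto_iff_dist_tendsto_zero.2 <| squeeze_zero (fun _ => dist_nonneg)
    (fun n => (Real.dist_eq _ _).trans_le (hbound n)) ?_
  simpa using (huv.const_mul (K + B)).add
    ((tendsto_const_mul_one_half_pow K).mul_const (∫ t, |v t|))

/-- The iterated convolution `S j ⋆ S (j + 1) ⋆ ⋯ ⋆ S (j + n)`. -/
noncomputable def iterConv (S : ℕ → ℝ → ℝ) : ℕ → ℕ → ℝ → ℝ
  | j, 0 => S j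
  | j, n + 1 => S j ⋆ iterConv S (j + 1) n

section iterConv

variable {S : ℕ → ℝ → ℝ}

lemma isKernel_iterConv (hS : ∀ n, IsKernel (S n) ((1 / 4) ^ n)) (j n : ℕ) :
    IsKernel (iterConv S j n) (2 * (1 / 4) ^ j) := by
  have hp : ∀ j : ℕ, (0 : ℝ) ≤ (1 / 4) ^ j := fun j => by positivity
  induction n generalizing j with
  | zero => exact (hS j).mono (by linarith [hp j])
  | succ n ih =>
    refine ((hS j).convolution (ih (j + 1))).mono ?_
    rw [pow_succ]
    linarith [hp j]

lemma iterConv_succ (hS : ∀ n, IsKernel (S n) ((1 / 4) ^ n)) (j n : ℕ) :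
    iterConv S j (n + 1) = iterConv S j n ⋆ S (j + n + 1) := by
  induction n generalizing j with
  | zero => rfl
  | succ n ih =>
    rw [iterConv, ih, iterConv, (hS j).convolution_assoc (isKernel_iterConv hS _ _)
      (hS _).continuous, show j + 1 + n + 1 = j + (n + 1) + 1 by omega]

lemma exists_abs_iterConv_sub_le (hS : ∀ n, IsKernel (S n) ((1 / 4) ^ n))
    (hlip : ∀ n, ∃ C : ℝ≥0, LipschitzWith C (S n)) (habs : ∀ n, ∫ x, |S n x| ≤ 2)
    (hone : ∀ n, |(∫ x, S n x) - 1| ≤ (1 / 4) ^ n) (j : ℕ) :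
    ∃ K, ∀ n x, |iterConv S j n x - iterConv S j (n + 1) x| ≤ K * (1 / 2) ^ n := by
  obtain ⟨C, hC⟩ := hlip j
  obtain ⟨B, hB0, hB⟩ := (hS j).exists_bound
  have hsucc : ∀ n, iterConv S j (n + 1) = S (j + n + 1) ⋆ iterConv S j n := fun n => by
    rw [iterConv_succ hS, convolution_comm_real]
  have hL : ∀ n x y, |iterConv S j n x - iterConv S j n y| ≤ 2 ^ n * C * |x - y| := by
    intro n
    induction n with
    | zero => simpa [iterConv, Real.dist_eq] using hC.dist_le_mul
    | succ n ih =>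
      intro x y
      rw [hsucc, pow_succ']
      refine ((hS _).abs_convolution_sub_le (isKernel_iterConv hS j n).continuous ih x y).trans ?_
      rw [mul_assoc 2]
      gcongr
      exact habs _
  have hM : ∀ n x, |iterConv S j n x| ≤ 2 ^ n * B := by
    intro n
    induction n with
    | zero => simpa [iterConv] using hB
    | succ n ih =>
      intro x
      rw [hsucc, pow_succ', mul_assoc 2]
      refine ((hS _).abs_convolution_le ih x).trans ?_
      gcongr
      exact habs _
  refine ⟨2 * C + B, fun n x => ?_⟩
  rw [abs_sub_comm, hsucc]
  refine ((hS _).abs_convolution_sub_self_le (isKernel_iterConv hS j n).continuous (by positivity)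
    (hL n) (hM n) x).trans ?_
  have hle : ((1 / 4 : ℝ)) ^ (j + n + 1) ≤ (1 / 4) ^ n :=
    pow_le_pow_of_le_one (by norm_num) (by norm_num) (by omega)
  have h4 : (2 : ℝ) ^ n * (1 / 4) ^ n = (1 / 2) ^ n := by
    rw [← mul_pow]
    norm_num
  calc _ ≤ 2 * (2 ^ n * C * (1 / 4) ^ n) + (1 / 4) ^ n * (2 ^ n * B) := by
        gcongr
        · exact habs _
        · exact (hone _).trans hle
    _ = (2 * C + B) * (2 ^ n * (1 / 4) ^ n) := by ring
    _ = _ := by rw [h4]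

/-- The infinite convolution product of Lipschitz approximate units is a smooth kernel. -/
lemma exists_iterConv_limit (hS : ∀ n, IsKernel (S n) ((1 / 4) ^ n))
    (hlip : ∀ n, ∃ C : ℝ≥0, LipschitzWith C (S n)) (habs : ∀ n, ∫ x, |S n x| ≤ 2)
    (hone : ∀ n, |(∫ x, S n x) - 1| ≤ (1 / 4) ^ n) :
    ∃ ρ K, IsKernel ρ 2 ∧ ContDiff ℝ ∞ ρ ∧ ∀ n x, |iterConv S 0 n x - ρ x| ≤ K * (1 / 2) ^ n := by
  choose K hK using exists_abs_iterConv_sub_le hS hlip habs hone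
  choose Q hQ hQK using fun j => exists_isKernel_limit (isKernel_iterConv hS j) (hK j)
  have hrec : ∀ j, Q j = S j ⋆ Q (j + 1) := by
    intro j
    ext x
    refine tendsto_nhds_unique ((tendsto_add_atTop_iff_nat 1).2
      (tendsto_of_abs_sub_le_one_half_pow fun n => hQK j n x)) ?_
    refine tendsto_of_abs_sub_le_one_half_pow (K := (∫ t, |S j t|) * (2 * K (j + 1))) fun n => ?_
    rw [iterConv, ← (hS j).convolution_sub (isKernel_iterConv hS _ _).continuous
      (hQ _).continuous, mul_assoc]
    exact (hS j).abs_convolution_le (hQK (j + 1) n) x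
  have hsmooth : ∀ (m : ℕ) (j : ℕ), ContDiff ℝ m (Q j) := by
    intro m
    induction m with
    | zero => exact fun j => contDiff_zero.2 (hQ j).continuous
    | succ m ih =>
      intro j
      obtain ⟨C, hC⟩ := hlip j
      rw [hrec j]
      exact_mod_cast (hS j).contDiff_convolution_succ hC (hQ (j + 1)) (ih (j + 1))
  exact ⟨Q 0, 2 * K 0, (hQ 0).mono (by norm_num), contDiff_infty.2 fun m => hsmooth m 0, hQK 0⟩

end iterConv

lemma IsKernel.iteratedDeriv_convolution {a b : ℝ → ℝ} {c : ℝ} (ha : IsKernel a c)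
    (hb : HasCompactSupport b) (hb' : ContDiff ℝ ∞ b) (m : ℕ) :
    iteratedDeriv m (a ⋆ b) = a ⋆ iteratedDeriv m b := by
  induction m generalizing b with
  | zero => simp
  | succ m ih =>
    have h : deriv (a ⋆ b) = a ⋆ deriv b := funext fun x =>
      (hb.hasDerivAt_convolution_right _ ha.continuous.locallyIntegrable
        (contDiff_infty.1 hb' 1) x).deriv
    rw [iteratedDeriv_succ', iteratedDeriv_succ', h,
      ih hb.deriv (contDiff_infty_iff_deriv.1 hb').2]

lemma IsKernel.add_sub_convolution {a b k : ℝ → ℝ} {c d e : ℝ} (ha : IsKernel a c)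
    (hb : IsKernel b d) (hk : IsKernel k e) {f : ℝ → ℝ} (hf : Continuous f) (x : ℝ) :
    ((fun t => a t + (b t - k t)) ⋆ f) x = (a ⋆ f) x + ((b ⋆ f) x - (k ⋆ f) x) := by
  simp only [convolution_lsmul, smul_eq_mul, add_mul, sub_mul]
  rw [← integral_sub (hb.integrable_mul hf x) (hk.integrable_mul hf x)]
  exact integral_add (ha.integrable_mul hf x)
    ((hb.integrable_mul hf x).sub (hk.integrable_mul hf x))

/-- With `δ` the unit for convolution,
`δ - remainderKernel r n = (δ - r 0) ⋆ (δ - r 1) ⋆ ⋯ ⋆ (δ - r n)`. -/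
noncomputable def remainderKernel (r : ℕ → ℝ → ℝ) : ℕ → ℝ → ℝ
  | 0 => r 0
  | n + 1 => fun x => remainderKernel r n x +
      (r (n + 1) x - (remainderKernel r n ⋆ r (n + 1)) x)

section remainderKernel

variable {r : ℕ → ℝ → ℝ}

lemma isKernel_remainderKernel (hr : ∀ n, IsKernel (r n) ((1 / 4) ^ n)) (n : ℕ) :
    IsKernel (remainderKernel r n) (2 - (1 / 4) ^ n) := by
  induction n with
  | zero => exact (hr 0).mono (by norm_num)
  | succ n ih =>
    have hp : (0 : ℝ) < (1 / 4) ^ n := by positivity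
    have hp1 : ((1 : ℝ) / 4) ^ n ≤ 1 := pow_le_one₀ (by norm_num) (by norm_num)
    have hs : ((1 : ℝ) / 4) ^ (n + 1) = (1 / 4) ^ n / 4 := by ring
    exact (ih.mono (by linarith)).add
      (((hr (n + 1)).mono (by linarith)).sub ((ih.convolution (hr (n + 1))).mono (by linarith)))

lemma contDiff_remainderKernel (hr : ∀ n, IsKernel (r n) ((1 / 4) ^ n))
    (hsm : ∀ n, ContDiff ℝ ∞ (r n)) (n : ℕ) : ContDiff ℝ ∞ (remainderKernel r n) := by
  induction n with
  | zero => exact hsm 0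
  | succ n ih =>
    exact ih.add ((hsm _).sub ((hr _).hasCompactSupport.contDiff_convolution_right _
      (isKernel_remainderKernel hr n).continuous.locallyIntegrable (hsm _)))

/-- The bound on the increments of `remainderKernel`, given a bound on the kernel itself. -/
lemma abs_iteratedDeriv_sub_convolution_le {a b : ℝ → ℝ} {c d M η : ℝ} {i : ℕ} (ha : IsKernel a c)
    (hc0 : 0 ≤ c) (hc : c ≤ 2) (hb : IsKernel b d) (hsm : ContDiff ℝ ∞ b)
    (hM : ∀ x, |a x| ≤ M) (hη : ∀ x, |iteratedDeriv i b x| ≤ η) (x : ℝ) :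
    |iteratedDeriv i (fun x => b x - (a ⋆ b) x) x| ≤ η * (1 + 2 * M) := by
  have hM0 : 0 ≤ M := (abs_nonneg _).trans (hM 0)
  have hη0 : 0 ≤ η := (abs_nonneg _).trans (hη 0)
  have hs : ContDiff ℝ ∞ (a ⋆ b) := hb.hasCompactSupport.contDiff_convolution_right _
    ha.continuous.locallyIntegrable hsm
  rw [iteratedDeriv_fun_sub (contDiff_infty.1 hsm i).contDiffAt
    (contDiff_infty.1 hs i).contDiffAt, ha.iteratedDeriv_convolution hb.hasCompactSupport hsm]
  calc _ ≤ |iteratedDeriv i b x| + |(a ⋆ iteratedDeriv i b) x| := abs_sub _ _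
    _ ≤ η + M * 2 * η := by
        refine add_le_add (hη x) ((ha.abs_convolution_le hη x).trans ?_)
        gcongr
        exact (ha.integral_abs_le hc0 hM).trans (by gcongr)
    _ = _ := by ring

lemma abs_remainderKernel_le (hr : ∀ n, IsKernel (r n) ((1 / 4) ^ n))
    (hsm : ∀ n, ContDiff ℝ ∞ (r n)) (hb : ∀ n x, |r n x| ≤ (1 / 4) ^ (n + 1)) (n : ℕ) (x : ℝ) :
    |remainderKernel r n x| ≤ (2 ^ (n + 1) - 1) / 2 := by
  induction n generalizing x with
  | zero => exact (hb 0 x).trans (by norm_num)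
  | succ n ih =>
    have hp1 : ((1 : ℝ) / 4) ^ n ≤ 1 := pow_le_one₀ (by norm_num) (by norm_num)
    have h := abs_iteratedDeriv_sub_convolution_le (i := 0) (isKernel_remainderKernel hr n)
      (by linarith) (by linarith [pow_pos (by norm_num : (0 : ℝ) < 1 / 4) n]) (hr (n + 1))
      (hsm (n + 1)) ih (η := (1 / 4) ^ (n + 1 + 1)) (by simpa using hb (n + 1)) x
    have h4 : ((1 : ℝ) / 4) ^ (n + 1 + 1) ≤ 1 / 4 := by
      rw [pow_succ, pow_succ]
      linarith
    have h2 : (0 : ℝ) < 2 ^ (n + 1) := by positivity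
    rw [iteratedDeriv_zero] at h
    refine (abs_add_le _ _).trans ((add_le_add (ih x) h).trans ?_)
    rw [pow_succ 2 (n + 1)]
    nlinarith

lemma abs_iteratedDeriv_remainderKernel_succ_sub_le (hr : ∀ n, IsKernel (r n) ((1 / 4) ^ n))
    (hsm : ∀ n, ContDiff ℝ ∞ (r n))
    (hb : ∀ n, ∀ i ≤ n, ∀ x, |iteratedDeriv i (r n) x| ≤ (1 / 4) ^ (n + 1)) {n i : ℕ} (hi : i ≤ n)
    (x : ℝ) : |iteratedDeriv i (fun x => remainderKernel r (n + 1) x - remainderKernel r n x) x| ≤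
      (1 / 2) ^ n := by
  have hp1 : ((1 : ℝ) / 4) ^ n ≤ 1 := pow_le_one₀ (by norm_num) (by norm_num)
  have h := abs_iteratedDeriv_sub_convolution_le (isKernel_remainderKernel hr n)
    (by linarith) (by linarith [pow_pos (by norm_num : (0 : ℝ) < 1 / 4) n]) (hr (n + 1))
    (hsm (n + 1)) (abs_remainderKernel_le hr hsm (fun n => by simpa using hb n 0 n.zero_le) n)
    (hb (n + 1) i (by omega)) x
  simp only [remainderKernel, add_sub_cancel_left]
  refine h.trans ?_
  have h4 : (1 / 4 : ℝ) ^ n * 2 ^ n = (1 / 2) ^ n := by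
    rw [← mul_pow]
    norm_num
  have h0 : (0 : ℝ) < (1 / 2) ^ n := by positivity
  calc _ = (1 / 8) * ((1 / 4 : ℝ) ^ n * 2 ^ n) := by ring
    _ ≤ _ := by
      rw [h4]
      linarith

lemma exists_remainderKernel_limit (hr : ∀ n, IsKernel (r n) ((1 / 4) ^ n))
    (hsm : ∀ n, ContDiff ℝ ∞ (r n))
    (hb : ∀ n, ∀ i ≤ n, ∀ x, |iteratedDeriv i (r n) x| ≤ (1 / 4) ^ (n + 1)) :
    ∃ ρ K, IsKernel ρ 2 ∧ ContDiff ℝ ∞ ρ ∧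
      ∀ n x, |remainderKernel r n x - ρ x| ≤ K * (1 / 2) ^ n := by
  have hinc := fun n i (hi : i ≤ n) => abs_iteratedDeriv_remainderKernel_succ_sub_le hr hsm hb hi
  have hinc0 : ∀ n x, |remainderKernel r (n + 1) x - remainderKernel r n x| ≤ (1 / 2) ^ n :=
    fun n => by simpa using hinc n 0 n.zero_le
  obtain ⟨ρ, hρ, hK⟩ := exists_isKernel_limit (F := remainderKernel r) (c := 2) (K := 1)
    (fun n => (isKernel_remainderKernel hr n).mono
      (by linarith [pow_pos (by norm_num : (0 : ℝ) < 1 / 4) n]))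
    (fun n x => by simpa [abs_sub_comm] using hinc0 n x)
  refine ⟨ρ, 2 * 1, hρ, ?_, hK⟩
  have hgeom : Summable fun n : ℕ => (1 / 2 : ℝ) ^ n :=
    summable_geometric_of_lt_one (by norm_num) (by norm_num)
  have hsum : ρ = fun x => remainderKernel r 0 x +
      ∑' n, (remainderKernel r (n + 1) x - remainderKernel r n x) := by
    ext x
    have h1 : Summable fun n => remainderKernel r (n + 1) x - remainderKernel r n x :=
      Summable.of_norm_bounded hgeom fun n => hinc0 n x
    have h2 := h1.hasSum.tendsto_sum_nat
    simp only [Finset.sum_range_sub fun n => remainderKernel r n x] at h2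
    rw [← tendsto_nhds_unique ((tendsto_of_abs_sub_le_one_half_pow fun n => hK n x).sub_const _) h2]
    ring
  rw [hsum]
  refine (contDiff_remainderKernel hr hsm 0).add ?_
  refine contDiff_tsum_of_eventually (v := fun _ n => (1 / 2 : ℝ) ^ n)
    (fun n => (contDiff_remainderKernel hr hsm _).sub (contDiff_remainderKernel hr hsm _))
    (fun _ _ => hgeom) fun i _ => ?_
  rw [Nat.cofinite_eq_atTop]
  filter_upwards [eventually_ge_atTop i] with n hn x
  rw [norm_iteratedFDeriv_eq_norm_iteratedDeriv]
  exact hinc n i hn x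

end remainderKernel

/-- Iterating the parametrix identities `F n = S n ⋆ F (n + 1) + r n ⋆ F n`. -/
lemma eq_remainderKernel_convolution_add {S r F : ℕ → ℝ → ℝ}
    (hS : ∀ n, IsKernel (S n) ((1 / 4) ^ n)) (hr : ∀ n, IsKernel (r n) ((1 / 4) ^ n))
    (hF : ∀ n, Continuous (F n))
    (h : ∀ n x, F n x = (S n ⋆ F (n + 1)) x + (r n ⋆ F n) x) (n : ℕ) (x : ℝ) :
    F 0 x = (remainderKernel r n ⋆ F 0) x + (iterConv S 0 n ⋆ F (n + 1)) x := by
  induction n generalizing x with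
  | zero => exact (h 0 x).trans (add_comm _ _)
  | succ n ih =>
    have hP := isKernel_iterConv hS 0 n
    have hR := isKernel_remainderKernel hr n
    have h1 : F (n + 1) = fun y => (S (n + 1) ⋆ F (n + 2)) y + (r (n + 1) ⋆ F (n + 1)) y :=
      funext (h (n + 1))
    have h2 : iterConv S 0 n ⋆ F (n + 1) = fun y => F 0 y - (remainderKernel r n ⋆ F 0) y :=
      funext fun y => by rw [ih y]; ring
    have h3 : iterConv S 0 (n + 1) ⋆ F (n + 2) = iterConv S 0 n ⋆ (S (n + 1) ⋆ F (n + 2)) := by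
      rw [iterConv_succ hS, zero_add, hP.convolution_assoc (hS _) (hF _)]
    have h4 : iterConv S 0 n ⋆ (r (n + 1) ⋆ F (n + 1)) =
        r (n + 1) ⋆ (iterConv S 0 n ⋆ F (n + 1)) := by
      rw [← hP.convolution_assoc (hr _) (hF _), convolution_comm_real (iterConv S 0 n),
        (hr _).convolution_assoc hP (hF _)]
    have h5 : (iterConv S 0 n ⋆ F (n + 1)) x = (iterConv S 0 (n + 1) ⋆ F (n + 2)) x +
        ((r (n + 1) ⋆ F 0) x - ((remainderKernel r n ⋆ r (n + 1)) ⋆ F 0) x) := by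
      conv_lhs => rw [h1]
      rw [hP.convolution_add ((hS _).continuous_convolution (hF _))
        ((hr _).continuous_convolution (hF _)), h3, h4, h2,
        (hr _).convolution_sub (hF 0) (hR.continuous_convolution (hF 0)),
        ← (hr _).convolution_assoc hR (hF 0),
        convolution_comm_real (r (n + 1)) (remainderKernel r n)]
    rw [remainderKernel, hR.add_sub_convolution (hr _) (hR.convolution (hr _)) (hF 0), ih x, h5]
    ring

/-- Dixmier–Malliavin type weak factorization: a smooth function whose
derivatives all belong to `L¹(ℝ)` can be written as `ρ₁ ⋆ f + ρ₂ ⋆ g`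
with `ρᵢ ∈ C_c^∞(ℝ)` and `g ∈ L¹(ℝ)`. -/
theorem dixmier_malliavin_factorization (f : ℝ → ℝ)
    (hf : ContDiff ℝ (⊤ : ℕ∞) f)
    (hint : ∀ k : ℕ, Integrable (iteratedDeriv k f)) :
    ∃ (g ρ₁ ρ₂ : ℝ → ℝ), Integrable g ∧
      ContDiff ℝ (⊤ : ℕ∞) ρ₁ ∧ HasCompactSupport ρ₁ ∧
      ContDiff ℝ (⊤ : ℕ∞) ρ₂ ∧ HasCompactSupport ρ₂ ∧
      ∀ x : ℝ, f x = (∫ y, ρ₁ (x - y) * f y) + ∫ y, ρ₂ (x - y) * g y := by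
  set T : ℕ → ℝ := fun n => ∑ k ∈ Finset.range (2 + 2 * n + 1), ∫ x, |iteratedDeriv k f x|
  have hT0 : ∀ n, 0 ≤ T n := fun n =>
    Finset.sum_nonneg fun k _ => integral_nonneg fun _ => abs_nonneg _
  have hδ : ∀ n, 0 < 1 / (3 * 8 ^ n * (1 + T n)) := fun n => by
    have := hT0 n
    positivity
  choose c S r hc0 hcδ hS hlip hS0 hr hrs hrb hid using fun n : ℕ =>
    exists_kernel_parametrix (ε := (1 / 4) ^ n) (η := (1 / 4) ^ (n + 1)) (by positivity)
      (by positivity) (hδ n) n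
  have hcT : ∀ n, c n * (3 * 8 ^ n * (1 + T n)) ≤ 1 := fun n => by
    have := hT0 n
    exact (le_div_iff₀ (by positivity)).1 (hcδ n)
  have hc1 : ∀ n, c n ≤ 1 := fun n => by
    refine (le_mul_of_one_le_right (hc0 n) ?_).trans (hcT n)
    have h8 : (1 : ℝ) ≤ 8 ^ n := one_le_pow₀ (by norm_num)
    nlinarith [hT0 n]
  have hF := contDiff_iterSqOnePlusDeriv (c := c) hf
  have hFint : ∀ n, Integrable (iterSqOnePlusDeriv c f n) := fun n => by
    simpa using integrable_iteratedDeriv_iterSqOnePlusDeriv (c := c) hf hint n 0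
  obtain ⟨g, hg, hlim⟩ := exists_integrable_tendsto_of_geometric hFint (K := 1) fun n => by
    refine (integral_abs_iterSqOnePlusDeriv_succ_sub_le hf hint hc0 hc1 n).trans ?_
    change c n * (3 * 4 ^ n * T n) ≤ _
    have h8 : (8 : ℝ) ^ n = 4 ^ n * 2 ^ n := by
      rw [← mul_pow]
      norm_num
    have h3 : c n * (3 * 4 ^ n * T n) ≤ c n * (3 * 4 ^ n * (1 + T n)) :=
      mul_le_mul_of_nonneg_left (by gcongr; linarith) (hc0 n)
    have h4 := hcT n
    rw [h8] at h4
    rw [one_mul, one_div, inv_pow, ← one_div, le_div_iff₀ (by positivity)]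
    refine (mul_le_mul_of_nonneg_right h3 (by positivity)).trans ?_
    linarith
  have hS1 : ∀ n, (∫ x, S n x) = 1 - ∫ x, r n x := fun n => by
    have h := hid n (fun _ => 1) contDiff_const 0
    simp [convolution_lsmul] at h
    linarith
  have hr1 : ∀ n, |∫ x, r n x| ≤ (1 / 4) ^ n := fun n => by
    refine (abs_integral_le_integral_abs).trans (((hr n).integral_abs_le (by positivity)
      (B := (1 / 4) ^ (n + 1)) (by simpa using hrb n 0 n.zero_le)).trans ?_)
    rw [← pow_add]
    exact pow_le_pow_of_le_one (by norm_num) (by norm_num) (by omega)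
  have hone : ∀ n, |(∫ x, S n x) - 1| ≤ (1 / 4) ^ n := fun n => by
    simpa [hS1 n] using hr1 n
  have habs : ∀ n, ∫ x, |S n x| ≤ 2 := fun n => by
    simp only [abs_of_nonneg (hS0 n _)]
    have h1 := (le_abs_self _).trans (hone n)
    have h2 : ((1 : ℝ) / 4) ^ n ≤ 1 := pow_le_one₀ (by norm_num) (by norm_num)
    linarith
  obtain ⟨ρ₁, K₁, hρ₁, hsm₁, hlim₁⟩ := exists_remainderKernel_limit hr hrs hrb
  obtain ⟨ρ₂, K₂, hρ₂, hsm₂, hlim₂⟩ := exists_iterConv_limit hS hlip habs hone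
  refine ⟨g, ρ₁, ρ₂, hg, hsm₁, hρ₁.hasCompactSupport, hsm₂, hρ₂.hasCompactSupport, fun x => ?_⟩
  have hstep := eq_remainderKernel_convolution_add hS hr (fun n => (hF n).continuous)
    fun n => hid n _ (contDiff_infty.1 (hF n) 2)
  simp only [convolution_lsmul_swap, smul_eq_mul] at hstep
  have l₁ := tendsto_convolution (u := fun _ => f) (fun n => (isKernel_remainderKernel hr n).mono
    (by linarith [pow_pos (by norm_num : (0 : ℝ) < 1 / 4) n])) hρ₁ hlim₁ (fun _ => hFint 0)
    (hFint 0) (by simp [iterSqOnePlusDeriv]) x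
  have l₂ := tendsto_convolution (fun n => (isKernel_iterConv hS 0 n).mono (by norm_num)) hρ₂ hlim₂
    (fun n => hFint (n + 1)) hg (hlim.comp (tendsto_add_atTop_nat 1)) x
  exact tendsto_nhds_unique (tendsto_const_nhds.congr fun n => hstep n x) (l₁.add l₂)
end

section
/- Multiplicative weak factorization: let F : (0,∞) → ℝ be smooth with ∫₀^∞ x^{k−1} |F^{(k)}(x)| dx < ∞ for every k ∈ ℕ. Then there exist Θ₁, Θ₂ ∈ C_c^∞(0,∞) and F₁, F₂ ∈ L¹(0,∞) such that F(x) = ∫₀^∞ [Θ₁(x/y) F₁(y) + Θ₂(x/y) F₂(y)] dy for all x > 0. -/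
open MeasureTheory Filter Topology

/-- The first-order operator `1 + c d/dt`. -/
noncomputable def addDeriv (c : ℝ) (f : ℝ → ℝ) (t : ℝ) : ℝ := f t + c * deriv f t

section Smooth

variable {f g : ℝ → ℝ}

theorem ContDiff.contDiff_nat_of_top (hf : ContDiff ℝ (⊤ : ℕ∞) f) (n : ℕ) : ContDiff ℝ n f :=
  hf.of_le (by exact_mod_cast le_top)

theorem ContDiff.hasDerivAt_of_top (hf : ContDiff ℝ (⊤ : ℕ∞) f) (t : ℝ) :
    HasDerivAt f (deriv f t) t :=
  (hf.differentiable (by simp) t).hasDerivAt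

theorem ContDiff.deriv_of_top (hf : ContDiff ℝ (⊤ : ℕ∞) f) : ContDiff ℝ (⊤ : ℕ∞) (deriv f) :=
  (contDiff_infty_iff_deriv.1 hf).2

theorem ContDiff.iteratedDeriv_of_top (hf : ContDiff ℝ (⊤ : ℕ∞) f) (k : ℕ) :
    ContDiff ℝ (⊤ : ℕ∞) (iteratedDeriv k f) := by
  rw [iteratedDeriv_eq_iterate]
  exact hf.iterate_deriv k

theorem ContDiff.hasDerivAt_iteratedDeriv (hf : ContDiff ℝ (⊤ : ℕ∞) f) (k : ℕ) (t : ℝ) :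
    HasDerivAt (iteratedDeriv k f) (iteratedDeriv (k + 1) f t) t := by
  rw [iteratedDeriv_succ]
  exact (hf.iteratedDeriv_of_top k).hasDerivAt_of_top t

theorem ContDiff.addDeriv (c : ℝ) (hf : ContDiff ℝ (⊤ : ℕ∞) f) :
    ContDiff ℝ (⊤ : ℕ∞) (addDeriv c f) :=
  hf.add (contDiff_const.mul hf.deriv_of_top)

theorem iteratedDeriv_addDeriv (c : ℝ) (hf : ContDiff ℝ (⊤ : ℕ∞) f) (k : ℕ) (t : ℝ) :
    iteratedDeriv k (addDeriv c f) t = iteratedDeriv k f t + c * iteratedDeriv (k + 1) f t := by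
  have h : addDeriv c f = fun t => f t + c * deriv f t := rfl
  rw [h, iteratedDeriv_fun_add (hf.contDiff_nat_of_top k).contDiffAt
    ((contDiff_const.mul hf.deriv_of_top).contDiff_nat_of_top k).contDiffAt,
    iteratedDeriv_const_mul_field, iteratedDeriv_succ']

/-- A chain of functions, each the derivative of the previous one, consists of smooth functions. -/
theorem contDiff_top_of_hasDerivAt_chain {f : ℕ → ℝ → ℝ}
    (h : ∀ k t, HasDerivAt (f k) (f (k + 1) t) t) : ContDiff ℝ (⊤ : ℕ∞) (f 0) := by
  have hk : ∀ k, iteratedDeriv k (f 0) = f k := by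
    intro k
    induction k with
    | zero => exact iteratedDeriv_zero
    | succ k ih => rw [iteratedDeriv_succ, ih]; exact funext fun t => (h k t).deriv
  refine contDiff_of_differentiable_iteratedDeriv fun m _ => ?_
  rw [hk]
  exact fun t => (h m t).differentiableAt

/-- Cutting a function off at a double zero preserves differentiability. -/
theorem HasDerivAt.indicator_Ioi {f' : ℝ → ℝ} (hf : ∀ t, HasDerivAt f (f' t) t)
    (h0 : f 0 = 0) (h0' : f' 0 = 0) (t : ℝ) :
    HasDerivAt ((Set.Ioi 0).indicator f) ((Set.Ioi 0).indicator f' t) t := by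
  rcases lt_trichotomy t 0 with ht | rfl | ht
  · rw [Set.indicator_of_notMem (by simpa using ht.le)]
    refine (hasDerivAt_const t (0 : ℝ)).congr_of_eventuallyEq ?_
    filter_upwards [Iio_mem_nhds ht] with s hs
    exact Set.indicator_of_notMem (by simpa using (Set.mem_Iio.1 hs).le) _
  · have h := hf 0
    rw [h0', hasDerivAt_iff_isLittleO] at h
    rw [Set.indicator_of_notMem (by simp), hasDerivAt_iff_isLittleO]
    refine Asymptotics.IsBigO.trans_isLittleO (Asymptotics.IsBigO.of_bound 1 ?_) h
    filter_upwards with s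
    by_cases hs : 0 < s <;> simp [Set.indicator, hs, h0]
  · rw [Set.indicator_of_mem (by simpa using ht)]
    refine (hf t).congr_of_eventuallyEq ?_
    filter_upwards [Ioi_mem_nhds ht] with s hs
    exact Set.indicator_of_mem hs _

theorem deriv_eq_zero_of_vanish {s : Set ℝ} (hs : IsClosed s) (hf : ∀ t ∉ s, f t = 0) :
    ∀ t ∉ s, deriv f t = 0 := by
  intro t ht
  have : f =ᶠ[𝓝 t] fun _ => 0 := by
    filter_upwards [hs.isOpen_compl.mem_nhds ht] with u hu using hf u hu
  rw [this.deriv_eq, deriv_const]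

theorem iteratedDeriv_eq_zero_of_vanish {s : Set ℝ} (hs : IsClosed s) (hf : ∀ t ∉ s, f t = 0)
    (k : ℕ) : ∀ t ∉ s, iteratedDeriv k f t = 0 := by
  induction k with
  | zero => simpa using hf
  | succ k ih => rw [iteratedDeriv_succ]; exact deriv_eq_zero_of_vanish hs ih

theorem addDeriv_eq_zero_of_vanish {s : Set ℝ} (hs : IsClosed s) (hf : ∀ t ∉ s, f t = 0) (c : ℝ) :
    ∀ t ∉ s, addDeriv c f t = 0 := by
  intro t ht
  simp [addDeriv, hf t ht, deriv_eq_zero_of_vanish hs hf t ht]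

theorem exists_bound_of_vanish (hf : Continuous f) {a b : ℝ} (h : ∀ t ∉ Set.Icc a b, f t = 0) :
    ∃ M, ∀ t, |f t| ≤ M := by
  obtain ⟨M, hM⟩ := (isCompact_Icc (a := a) (b := b)).exists_bound_of_continuousOn hf.continuousOn
  refine ⟨max M 0, fun t => ?_⟩
  by_cases ht : t ∈ Set.Icc a b
  · exact (hM t ht).trans (le_max_left _ _)
  · simp [h t ht]

/-- Integration by parts against a reflected translate. -/
theorem integral_mul_addDeriv_sub (hf : ContDiff ℝ (⊤ : ℕ∞) f) (hg : ContDiff ℝ (⊤ : ℕ∞) g)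
    (c t a b : ℝ) :
    ∫ u in a..b, f u * addDeriv c g (t - u) =
      c * (f a * g (t - a) - f b * g (t - b)) + ∫ u in a..b, addDeriv c f u * g (t - u) := by
  have hgr : ∀ u, HasDerivAt (fun u => g (t - u)) (-deriv g (t - u)) u := fun u => by
    simpa using HasDerivAt.comp_const_sub t u (hg.hasDerivAt_of_top (t - u))
  have cf := hf.continuous
  have cf' := hf.deriv_of_top.continuous
  have cg : Continuous fun u => g (t - u) := hg.continuous.comp (by fun_prop)
  have cg' : Continuous fun u => deriv g (t - u) := hg.deriv_of_top.continuous.comp (by fun_prop)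
  have key := intervalIntegral.integral_mul_deriv_eq_deriv_mul (a := a) (b := b)
    (fun u _ => hf.hasDerivAt_of_top u) (fun u _ => hgr u)
    (cf'.intervalIntegrable _ _) (cg'.neg.intervalIntegrable _ _)
  have e1 : ∫ u in a..b, f u * addDeriv c g (t - u) =
      (∫ u in a..b, f u * g (t - u)) - c * ∫ u in a..b, f u * -deriv g (t - u) := by
    rw [← intervalIntegral.integral_const_mul, ← intervalIntegral.integral_sub]
    · exact intervalIntegral.integral_congr fun u _ => by simp only [addDeriv]; ring
    · exact (cf.mul cg).intervalIntegrable _ _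
    · exact (continuous_const.mul (cf.mul cg'.neg)).intervalIntegrable _ _
  have e2 : ∫ u in a..b, addDeriv c f u * g (t - u) =
      (∫ u in a..b, f u * g (t - u)) + c * ∫ u in a..b, deriv f u * g (t - u) := by
    rw [← intervalIntegral.integral_const_mul, ← intervalIntegral.integral_add]
    · exact intervalIntegral.integral_congr fun u _ => by simp only [addDeriv]; ring
    · exact (cf.mul cg).intervalIntegrable _ _
    · exact (continuous_const.mul (cf'.mul cg)).intervalIntegrable _ _
  rw [e1, e2, key]
  ring

/-- A comparison principle for `y + c y' = f`. -/
theorem abs_le_of_abs_addDeriv_le (hf : ContDiff ℝ (⊤ : ℕ∞) f) {c M : ℝ} (hc : 0 < c)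
    (hM : ∀ t, 0 ≤ t → |addDeriv c f t| ≤ M) {t : ℝ} (ht : 0 ≤ t) :
    |f t| ≤ M + Real.exp (-t / c) * |f 0| := by
  have upper : ∀ h : ℝ → ℝ, ContDiff ℝ (⊤ : ℕ∞) h → (∀ s, 0 ≤ s → addDeriv c h s ≤ M) →
      h t ≤ M + Real.exp (-t / c) * (h 0 - M) := by
    intro h hh hb
    have hd : ∀ s, HasDerivAt (fun s => Real.exp (s / c) * (h s - M))
        (Real.exp (s / c) * (1 / c) * (h s - M) + Real.exp (s / c) * deriv h s) s := fun s =>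
      (((hasDerivAt_id s).div_const c).exp).mul ((hh.hasDerivAt_of_top s).sub_const M)
    have hanti : AntitoneOn (fun s => Real.exp (s / c) * (h s - M)) (Set.Ici 0) := by
      refine antitoneOn_of_deriv_nonpos (convex_Ici 0)
        (fun s _ => (hd s).continuousAt.continuousWithinAt)
        (fun s _ => (hd s).differentiableAt.differentiableWithinAt) fun s hs => ?_
      rw [interior_Ici] at hs
      rw [(hd s).deriv]
      have e : Real.exp (s / c) * (1 / c) * (h s - M) + Real.exp (s / c) * deriv h s =
          Real.exp (s / c) * (1 / c) * (addDeriv c h s - M) := by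
        simp only [addDeriv]; field_simp; ring
      rw [e]
      exact mul_nonpos_of_nonneg_of_nonpos (by positivity) (by linarith [hb s (Set.mem_Ioi.1 hs).le])
    have h1 := hanti (Set.mem_Ici.2 le_rfl) (Set.mem_Ici.2 ht) ht
    simp only [zero_div, Real.exp_zero, one_mul] at h1
    have h2 := mul_le_mul_of_nonneg_left h1 (Real.exp_pos (-t / c)).le
    rw [← mul_assoc, ← Real.exp_add, neg_div, neg_add_cancel, Real.exp_zero, one_mul] at h2
    rw [neg_div]; linarith
  have hM0 : 0 ≤ M := (abs_nonneg _).trans (hM 0 le_rfl)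
  have he := (Real.exp_pos (-t / c)).le
  have h1 := upper f hf fun s hs => (abs_le.1 (hM s hs)).2
  have h2 := upper (fun s => -f s) hf.neg fun s hs => by
    have : addDeriv c (fun s => -f s) s = -addDeriv c f s := by
      simp [addDeriv, deriv.fun_neg]; ring
    rw [this]; linarith [(abs_le.1 (hM s hs)).1]
  have h3 := mul_le_mul_of_nonneg_left (sub_le_self (f 0) hM0 |>.trans (le_abs_self _)) he
  have h4 := mul_le_mul_of_nonneg_left (sub_le_self (-f 0) hM0 |>.trans (neg_le_abs _)) he
  exact abs_le.2 ⟨by linarith, by linarith⟩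

end Smooth

/-- The solution of `y + c y' = f` with `y 0 = 0`. -/
noncomputable def solveODE (c : ℝ) (f : ℝ → ℝ) (t : ℝ) : ℝ :=
  Real.exp (-t / c) * ∫ s in (0 : ℝ)..t, c⁻¹ * Real.exp (s / c) * f s

section ODE

variable {f : ℝ → ℝ} {c : ℝ}

theorem solveODE_zero (c : ℝ) (f : ℝ → ℝ) : solveODE c f 0 = 0 := by simp [solveODE]

theorem hasDerivAt_solveODE (hf : Continuous f) (t : ℝ) :
    HasDerivAt (solveODE c f) (c⁻¹ * (f t - solveODE c f t)) t := by
  have hcont : Continuous fun s => c⁻¹ * Real.exp (s / c) * f s := by fun_prop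
  have h1 := hcont.integral_hasStrictDerivAt 0 t |>.hasDerivAt
  have h2 : HasDerivAt (fun t : ℝ => Real.exp (-t / c)) (Real.exp (-t / c) * (-1 / c)) t :=
    ((hasDerivAt_neg t).div_const c).exp
  refine (h2.mul h1).congr_deriv ?_
  have e : Real.exp (-t / c) * Real.exp (t / c) = 1 := by
    rw [← Real.exp_add, neg_div, neg_add_cancel, Real.exp_zero]
  simp only [solveODE]
  linear_combination c⁻¹ * f t * e

theorem contDiff_solveODE (hf : ContDiff ℝ (⊤ : ℕ∞) f) : ContDiff ℝ (⊤ : ℕ∞) (solveODE c f) := by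
  refine contDiff_infty.2 fun n => ?_
  induction n with
  | zero =>
    exact contDiff_zero.2 (continuous_iff_continuousAt.2 fun t =>
      (hasDerivAt_solveODE hf.continuous t).continuousAt)
  | succ n ih =>
    have hd : deriv (solveODE c f) = fun t => c⁻¹ * (f t - solveODE c f t) :=
      funext fun t => (hasDerivAt_solveODE hf.continuous t).deriv
    push_cast
    refine contDiff_succ_iff_deriv.2
      ⟨fun t => (hasDerivAt_solveODE hf.continuous t).differentiableAt, by simp, ?_⟩
    rw [hd]
    exact contDiff_const.mul ((hf.contDiff_nat_of_top n).sub ih)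

theorem addDeriv_solveODE (hc : c ≠ 0) (hf : Continuous f) : addDeriv c (solveODE c f) = f := by
  funext t
  rw [addDeriv, (hasDerivAt_solveODE hf t).deriv]
  field_simp
  ring

end ODE

/-- `(1 + D) ∏ (1 + c D)` over the list, applied from the inside out. -/
noncomputable def prodAddDeriv : List ℝ → (ℝ → ℝ) → ℝ → ℝ
  | [], f => addDeriv 1 f
  | c :: L, f => addDeriv c (prodAddDeriv L f)

/-- `(1 + D) ∏ (1 + c D)` over the list, applied from the outside in. -/
noncomputable def prodAddDeriv' : List ℝ → (ℝ → ℝ) → ℝ → ℝ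
  | [], f => addDeriv 1 f
  | c :: L, f => prodAddDeriv' L (addDeriv c f)

/-- The fundamental solution on `[0,∞)` of the operator `prodAddDeriv L`. -/
noncomputable def fundSol : List ℝ → ℝ → ℝ
  | [] => fun t => Real.exp (-t)
  | c :: L => solveODE c (fundSol L)

/-- A smooth cutoff equal to `1` on `(-∞,1]` and to `0` on `[2,∞)`. -/
noncomputable def cutoff (t : ℝ) : ℝ := Real.smoothTransition (2 - t)

/-- The error produced by truncating `fundSol L` when the head of `L` is adjoined. -/
noncomputable def truncTerm : List ℝ → ℝ → ℝ
  | [] => fun t => -(deriv cutoff t * Real.exp (-t))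
  | c :: L => fun t => -(c * prodAddDeriv' L (fun s => deriv cutoff s * fundSol (c :: L) s) t)

/-- The total truncation error. -/
noncomputable def truncSum : List ℝ → ℝ → ℝ
  | [] => truncTerm []
  | c :: L => fun t => truncSum L t + truncTerm (c :: L) t

section Cutoff

theorem contDiff_cutoff : ContDiff ℝ (⊤ : ℕ∞) cutoff :=
  Real.smoothTransition.contDiff.comp (contDiff_const.sub contDiff_id)

theorem cutoff_of_le_one {t : ℝ} (ht : t ≤ 1) : cutoff t = 1 :=
  Real.smoothTransition.one_of_one_le (by linarith)

theorem cutoff_of_two_le {t : ℝ} (ht : 2 ≤ t) : cutoff t = 0 :=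
  Real.smoothTransition.zero_of_nonpos (by linarith)

theorem abs_cutoff_le_one (t : ℝ) : |cutoff t| ≤ 1 := by
  rw [cutoff, abs_of_nonneg (Real.smoothTransition.nonneg _)]
  exact Real.smoothTransition.le_one _

theorem deriv_cutoff_eq_zero : ∀ t ∉ Set.Icc (1 : ℝ) 2, deriv cutoff t = 0 := by
  intro t ht
  rcases lt_or_ge t 1 with h | h
  · have : cutoff =ᶠ[𝓝 t] fun _ => 1 := by
      filter_upwards [Iio_mem_nhds h] with u hu using cutoff_of_le_one (Set.mem_Iio.1 hu).le
    rw [this.deriv_eq, deriv_const]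
  · have h2 : 2 < t := by
      by_contra! h2
      exact ht ⟨h, h2⟩
    have : cutoff =ᶠ[𝓝 t] fun _ => 0 := by
      filter_upwards [Ioi_mem_nhds h2] with u hu using cutoff_of_two_le (Set.mem_Ioi.1 hu).le
    rw [this.deriv_eq, deriv_const]

end Cutoff

section Operators

variable {f g : ℝ → ℝ}

theorem contDiff_prodAddDeriv (L : List ℝ) (hf : ContDiff ℝ (⊤ : ℕ∞) f) :
    ContDiff ℝ (⊤ : ℕ∞) (prodAddDeriv L f) := by
  induction L with
  | nil => exact hf.addDeriv 1
  | cons c L ih => exact ih.addDeriv c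

theorem contDiff_prodAddDeriv' (L : List ℝ) (hf : ContDiff ℝ (⊤ : ℕ∞) f) :
    ContDiff ℝ (⊤ : ℕ∞) (prodAddDeriv' L f) := by
  induction L generalizing f with
  | nil => exact hf.addDeriv 1
  | cons c L ih => exact ih (hf.addDeriv c)

theorem prodAddDeriv'_eq_zero_of_vanish (L : List ℝ) {s : Set ℝ} (hs : IsClosed s)
    (hf : ∀ t ∉ s, f t = 0) : ∀ t ∉ s, prodAddDeriv' L f t = 0 := by
  induction L generalizing f with
  | nil => exact addDeriv_eq_zero_of_vanish hs hf 1
  | cons c L ih => exact ih (addDeriv_eq_zero_of_vanish hs hf c)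

theorem integrable_iteratedDeriv_prodAddDeriv (L : List ℝ) (hf : ContDiff ℝ (⊤ : ℕ∞) f)
    (hint : ∀ k, Integrable (iteratedDeriv k f)) (k : ℕ) :
    Integrable (iteratedDeriv k (prodAddDeriv L f)) := by
  have step : ∀ (c : ℝ) (h : ℝ → ℝ), ContDiff ℝ (⊤ : ℕ∞) h →
      (∀ k, Integrable (iteratedDeriv k h)) → ∀ k, Integrable (iteratedDeriv k (addDeriv c h)) := by
    intro c h hh hi k
    rw [funext (iteratedDeriv_addDeriv c hh k)]
    exact (hi k).add ((hi (k + 1)).const_mul c)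
  induction L generalizing k with
  | nil => exact step 1 f hf hint k
  | cons c L ih => exact step c _ (contDiff_prodAddDeriv L hf) ih k

/-- The operators are bounded uniformly on families with uniformly bounded derivatives. -/
theorem exists_bound_iteratedDeriv_prodAddDeriv' (L : List ℝ) (k : ℕ) (B : ℕ → ℝ) :
    ∃ C, ∀ f : ℝ → ℝ, ContDiff ℝ (⊤ : ℕ∞) f → (∀ j t, |iteratedDeriv j f t| ≤ B j) →
      ∀ t, |iteratedDeriv k (prodAddDeriv' L f) t| ≤ C := by
  have step : ∀ (c : ℝ) (B : ℕ → ℝ) (f : ℝ → ℝ), ContDiff ℝ (⊤ : ℕ∞) f →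
      (∀ j t, |iteratedDeriv j f t| ≤ B j) → ∀ j t, |iteratedDeriv j (addDeriv c f) t| ≤
        B j + |c| * B (j + 1) := by
    intro c B f hf hb j t
    rw [iteratedDeriv_addDeriv c hf]
    refine (abs_add_le _ _).trans (add_le_add (hb j t) ?_)
    rw [abs_mul]
    exact mul_le_mul_of_nonneg_left (hb (j + 1) t) (abs_nonneg c)
  induction L generalizing B with
  | nil => exact ⟨_, fun f hf hb => step 1 B f hf hb k⟩
  | cons c L ih =>
    obtain ⟨C, hC⟩ := ih fun j => B j + |c| * B (j + 1)
    exact ⟨C, fun f hf hb => hC _ (hf.addDeriv c) (step c B f hf hb)⟩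

theorem integral_mul_prodAddDeriv_sub (L : List ℝ) (hf : ContDiff ℝ (⊤ : ℕ∞) f)
    (hg : ContDiff ℝ (⊤ : ℕ∞) g) (hv : ∀ t ∉ Set.Icc (1 : ℝ) 2, f t = 0) (t : ℝ) :
    ∫ u in (0 : ℝ)..3, f u * prodAddDeriv L g (t - u) =
      ∫ u in (0 : ℝ)..3, prodAddDeriv' L f u * g (t - u) := by
  have key : ∀ (c : ℝ) (f g : ℝ → ℝ), ContDiff ℝ (⊤ : ℕ∞) f → ContDiff ℝ (⊤ : ℕ∞) g →
      (∀ t ∉ Set.Icc (1 : ℝ) 2, f t = 0) →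
      ∫ u in (0 : ℝ)..3, f u * addDeriv c g (t - u) =
        ∫ u in (0 : ℝ)..3, addDeriv c f u * g (t - u) := by
    intro c f g hf hg hv
    rw [integral_mul_addDeriv_sub hf hg, hv 0 (by norm_num), hv 3 (by norm_num)]
    simp
  induction L generalizing f with
  | nil => exact key 1 f g hf hg hv
  | cons c L ih =>
    exact (key c f _ hf (contDiff_prodAddDeriv L hg) hv).trans
      (ih (hf.addDeriv c) (addDeriv_eq_zero_of_vanish isClosed_Icc hv c))

end Operators

section FundSol

theorem contDiff_fundSol (L : List ℝ) : ContDiff ℝ (⊤ : ℕ∞) (fundSol L) := by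
  induction L with
  | nil => exact Real.contDiff_exp.comp contDiff_neg
  | cons c L ih => exact contDiff_solveODE ih

theorem addDeriv_fundSol {c : ℝ} (hc : 0 < c) (L : List ℝ) :
    addDeriv c (fundSol (c :: L)) = fundSol L :=
  addDeriv_solveODE hc.ne' (contDiff_fundSol L).continuous

theorem iteratedDeriv_fundSol_add {c : ℝ} (hc : 0 < c) (L : List ℝ) (k : ℕ) (t : ℝ) :
    iteratedDeriv k (fundSol (c :: L)) t + c * iteratedDeriv (k + 1) (fundSol (c :: L)) t =
      iteratedDeriv k (fundSol L) t := by
  rw [← iteratedDeriv_addDeriv c (contDiff_fundSol _), addDeriv_fundSol hc]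

theorem iteratedDeriv_fundSol_zero {L : List ℝ} (hL : ∀ c ∈ L, 0 < c) {k : ℕ}
    (hk : k < L.length) : iteratedDeriv k (fundSol L) 0 = 0 := by
  induction L generalizing k with
  | nil => simp at hk
  | cons c L ih =>
    have hc : 0 < c := hL c (by simp)
    induction k with
    | zero => simp [fundSol, solveODE_zero]
    | succ k ihk =>
      have h := iteratedDeriv_fundSol_add hc L k 0
      rw [ihk (by omega), ih (fun d hd => hL d (by simp [hd])) (by simpa using hk), zero_add] at h
      exact (mul_eq_zero.1 h).resolve_left hc.ne'

theorem abs_iteratedDeriv_fundSol_le {c M : ℝ} (hc : 0 < c) {L : List ℝ} {k : ℕ}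
    (hM : ∀ t, 0 ≤ t → |iteratedDeriv k (fundSol L) t| ≤ M) {t : ℝ} (ht : 0 ≤ t) :
    |iteratedDeriv k (fundSol (c :: L)) t| ≤
      M + Real.exp (-t / c) * |iteratedDeriv k (fundSol (c :: L)) 0| := by
  refine abs_le_of_abs_addDeriv_le ((contDiff_fundSol _).iteratedDeriv_of_top k) hc
    (fun s hs => ?_) ht
  rw [addDeriv, ← iteratedDeriv_succ, iteratedDeriv_fundSol_add hc]
  exact hM s hs

theorem exists_bound_iteratedDeriv_fundSol {L : List ℝ} (hL : ∀ c ∈ L, 0 < c) (k : ℕ) :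
    ∃ M, ∀ t, 0 ≤ t → |iteratedDeriv k (fundSol L) t| ≤ M := by
  induction L with
  | nil =>
    refine ⟨1, fun t ht => ?_⟩
    have h : iteratedDeriv k (fundSol []) t = (-1) ^ k * Real.exp (-t) := by
      have := congrFun (iteratedDeriv_exp_const_mul k (-1)) t
      simpa [fundSol] using this
    rw [h, abs_mul, abs_pow, abs_neg, abs_one, one_pow, one_mul, Real.abs_exp]
    exact Real.exp_le_one_iff.2 (by linarith)
  | cons c L ih =>
    have hc : 0 < c := hL c (by simp)
    obtain ⟨M, hM⟩ := ih fun d hd => hL d (by simp [hd])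
    refine ⟨M + |iteratedDeriv k (fundSol (c :: L)) 0|, fun t ht =>
      (abs_iteratedDeriv_fundSol_le hc hM ht).trans (add_le_add_right ?_ _)⟩
    refine mul_le_of_le_one_left (abs_nonneg _) (Real.exp_le_one_iff.2 ?_)
    exact div_nonpos_of_nonpos_of_nonneg (by linarith) hc.le

/-- Away from the origin, the derivatives stay bounded as the adjoined parameter shrinks. -/
theorem exists_uniform_bound_iteratedDeriv_fundSol {L : List ℝ} (hL : ∀ c ∈ L, 0 < c) (k : ℕ) :
    ∃ M, ∀ c, 0 < c → c ≤ 1 → ∀ t, 1 ≤ t → |iteratedDeriv k (fundSol (c :: L)) t| ≤ M := by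
  have hinit : ∃ A, 0 ≤ A ∧ ∀ c, 0 < c → c ≤ 1 →
      |iteratedDeriv k (fundSol (c :: L)) 0| ≤ A * (1 / c) ^ k := by
    induction k with
    | zero => exact ⟨0, le_rfl, fun c _ _ => by simp [fundSol, solveODE_zero]⟩
    | succ k ih =>
      obtain ⟨A, hA0, hA⟩ := ih
      refine ⟨|iteratedDeriv k (fundSol L) 0| + A, by positivity, fun c hc hc1 => ?_⟩
      have h := iteratedDeriv_fundSol_add hc L k 0
      have e : iteratedDeriv (k + 1) (fundSol (c :: L)) 0 =
          (1 / c) * (iteratedDeriv k (fundSol L) 0 - iteratedDeriv k (fundSol (c :: L)) 0) := by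
        rw [← h]; field_simp; ring
      have h1 : (1 : ℝ) ≤ (1 / c) ^ k := one_le_pow₀ (by rw [le_div_iff₀ hc]; linarith)
      rw [e, abs_mul, abs_of_pos (by positivity : 0 < 1 / c), pow_succ']
      calc 1 / c * |iteratedDeriv k (fundSol L) 0 - iteratedDeriv k (fundSol (c :: L)) 0|
          ≤ 1 / c * (|iteratedDeriv k (fundSol L) 0| + A * (1 / c) ^ k) := by
            gcongr
            exact (abs_sub _ _).trans (add_le_add_right (hA c hc hc1) _)
        _ ≤ 1 / c * (|iteratedDeriv k (fundSol L) 0| * (1 / c) ^ k + A * (1 / c) ^ k) := by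
            gcongr
            exact le_mul_of_one_le_right (abs_nonneg _) h1
        _ = _ := by ring
  obtain ⟨A, hA0, hA⟩ := hinit
  obtain ⟨M, hM⟩ := exists_bound_iteratedDeriv_fundSol hL k
  refine ⟨M + A * k.factorial, fun c hc hc1 t ht => ?_⟩
  refine (abs_iteratedDeriv_fundSol_le hc hM (by linarith)).trans (add_le_add_right ?_ _)
  have h1 : (1 / c) ^ k / k.factorial ≤ Real.exp (1 / c) :=
    Real.pow_div_factorial_le_exp _ (by positivity) k
  have h2 : Real.exp (-t / c) ≤ Real.exp (-(1 / c)) := by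
    refine Real.exp_le_exp.2 ?_
    rw [neg_div]
    exact neg_le_neg (by gcongr)
  have h3 : (1 / c) ^ k ≤ k.factorial * Real.exp (1 / c) := by
    rwa [div_le_iff₀' (by positivity)] at h1
  calc Real.exp (-t / c) * |iteratedDeriv k (fundSol (c :: L)) 0|
      ≤ Real.exp (-(1 / c)) * (A * (k.factorial * Real.exp (1 / c))) := by
        gcongr
        exact (hA c hc hc1).trans (by gcongr)
    _ = A * k.factorial * (Real.exp (-(1 / c)) * Real.exp (1 / c)) := by ring
    _ = A * k.factorial := by rw [← Real.exp_add, neg_add_cancel, Real.exp_zero, mul_one]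

theorem contDiff_deriv_cutoff_mul_fundSol (L : List ℝ) :
    ContDiff ℝ (⊤ : ℕ∞) fun s => deriv cutoff s * fundSol L s :=
  contDiff_cutoff.deriv_of_top.mul (contDiff_fundSol L)

theorem deriv_cutoff_mul_eq_zero (f : ℝ → ℝ) :
    ∀ t ∉ Set.Icc (1 : ℝ) 2, deriv cutoff t * f t = 0 := fun t ht => by
  rw [deriv_cutoff_eq_zero t ht, zero_mul]

theorem exists_uniform_bound_iteratedDeriv_deriv_cutoff_mul {L : List ℝ} (hL : ∀ c ∈ L, 0 < c)
    (k : ℕ) : ∃ M, ∀ c, 0 < c → c ≤ 1 → ∀ t,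
      |iteratedDeriv k (fun s => deriv cutoff s * fundSol (c :: L) s) t| ≤ M := by
  choose B hB using exists_uniform_bound_iteratedDeriv_fundSol hL
  have hK : ∀ i, ∃ K, ∀ t, |iteratedDeriv i (deriv cutoff) t| ≤ K := fun i =>
    exists_bound_of_vanish (contDiff_cutoff.deriv_of_top.iteratedDeriv_of_top i).continuous
      (iteratedDeriv_eq_zero_of_vanish isClosed_Icc deriv_cutoff_eq_zero i)
  choose K hK using hK
  refine ⟨∑ i ∈ Finset.range (k + 1), (k.choose i : ℝ) * K i * |B (k - i)|, fun c hc hc1 t => ?_⟩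
  rw [iteratedDeriv_fun_mul (contDiff_cutoff.deriv_of_top.contDiff_nat_of_top k).contDiffAt
    ((contDiff_fundSol _).contDiff_nat_of_top k).contDiffAt]
  refine (Finset.abs_sum_le_sum_abs _ _).trans (Finset.sum_le_sum fun i _ => ?_)
  have hK0 : 0 ≤ K i := (abs_nonneg _).trans (hK i t)
  by_cases ht : t ∈ Set.Icc (1 : ℝ) 2
  · rw [abs_mul, abs_mul, Nat.abs_cast]
    exact mul_le_mul (mul_le_mul_of_nonneg_left (hK i t) (Nat.cast_nonneg _))
      ((hB (k - i) c hc hc1 t ht.1).trans (le_abs_self _)) (abs_nonneg _) (by positivity)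
  · rw [iteratedDeriv_eq_zero_of_vanish isClosed_Icc deriv_cutoff_eq_zero i t ht]
    simp only [mul_zero, zero_mul, abs_zero]
    positivity

theorem contDiff_truncTerm (L : List ℝ) : ContDiff ℝ (⊤ : ℕ∞) (truncTerm L) := by
  cases L with
  | nil => exact (contDiff_deriv_cutoff_mul_fundSol []).neg
  | cons c L =>
    exact (contDiff_const.mul
      (contDiff_prodAddDeriv' L (contDiff_deriv_cutoff_mul_fundSol (c :: L)))).neg

theorem truncTerm_eq_zero (L : List ℝ) : ∀ t ∉ Set.Icc (1 : ℝ) 2, truncTerm L t = 0 := by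
  intro t ht
  cases L with
  | nil => simp [truncTerm, deriv_cutoff_eq_zero t ht]
  | cons c L =>
    simp [truncTerm, prodAddDeriv'_eq_zero_of_vanish L isClosed_Icc
      (deriv_cutoff_mul_eq_zero (fundSol (c :: L))) t ht]

theorem contDiff_truncSum (L : List ℝ) : ContDiff ℝ (⊤ : ℕ∞) (truncSum L) := by
  induction L with
  | nil => exact contDiff_truncTerm []
  | cons c L ih => exact ih.add (contDiff_truncTerm _)

theorem truncSum_eq_zero (L : List ℝ) : ∀ t ∉ Set.Icc (1 : ℝ) 2, truncSum L t = 0 := by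
  intro t ht
  induction L with
  | nil => exact truncTerm_eq_zero [] t ht
  | cons c L ih => simp [truncSum, ih, truncTerm_eq_zero (c :: L) t ht]

theorem addDeriv_cutoff_mul (c : ℝ) {f : ℝ → ℝ} (hf : ContDiff ℝ (⊤ : ℕ∞) f) (u : ℝ) :
    addDeriv c (fun s => cutoff s * f s) u =
      cutoff u * addDeriv c f u + c * (deriv cutoff u * f u) := by
  have h := ((contDiff_cutoff.hasDerivAt_of_top u).mul (hf.hasDerivAt_of_top u)).deriv
  have h' : deriv (fun s => cutoff s * f s) u = _ := h
  rw [addDeriv, h', addDeriv]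
  ring

/-- The factorization through a finite product of first-order operators. -/
theorem eq_integral_fundSol_add_truncSum {L : List ℝ} (hL : ∀ c ∈ L, 0 < c) {G : ℝ → ℝ}
    (hG : ContDiff ℝ (⊤ : ℕ∞) G) (t : ℝ) :
    G t = (∫ u in (0 : ℝ)..3, cutoff u * fundSol L u * prodAddDeriv L G (t - u)) +
      ∫ u in (0 : ℝ)..3, truncSum L u * G (t - u) := by
  have hκ := contDiff_cutoff.deriv_of_top.continuous
  have hGt : Continuous fun u => G (t - u) := hG.continuous.comp (by fun_prop)
  induction L with
  | nil =>
    have h := integral_mul_addDeriv_sub (contDiff_cutoff.mul (contDiff_fundSol [])) hG 1 t 0 3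
    simp only [prodAddDeriv]
    rw [h, add_assoc, ← intervalIntegral.integral_add]
    · have h0 : ∀ u ∈ Set.uIcc (0 : ℝ) 3, addDeriv 1 (fun s => cutoff s * fundSol [] s) u *
          G (t - u) + truncSum [] u * G (t - u) = 0 := by
        intro u _
        have hd : addDeriv 1 (fundSol []) u = 0 := by
          have : deriv (fundSol []) u = -Real.exp (-u) := by
            simpa [fundSol] using (((hasDerivAt_neg u).exp).deriv)
          rw [addDeriv, this]; simp [fundSol]
        rw [addDeriv_cutoff_mul 1 (contDiff_fundSol []), hd]
        simp only [truncSum, truncTerm, fundSol]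
        ring
      rw [intervalIntegral.integral_congr (g := fun _ => 0) h0]
      simp [cutoff_of_le_one, cutoff_of_two_le (show (2 : ℝ) ≤ 3 by norm_num), fundSol]
    · exact ((((contDiff_cutoff.mul (contDiff_fundSol [])).addDeriv 1).continuous).mul
        hGt).intervalIntegrable _ _
    · exact ((contDiff_truncSum []).continuous.mul hGt).intervalIntegrable _ _
  | cons c L ih =>
    have hc : 0 < c := hL c (by simp)
    have hP := contDiff_prodAddDeriv L hG
    have hPt : Continuous fun u => prodAddDeriv L G (t - u) := hP.continuous.comp (by fun_prop)
    have hE := contDiff_fundSol L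
    have hE' := contDiff_fundSol (c :: L)
    have h := integral_mul_addDeriv_sub (contDiff_cutoff.mul hE') hP c t 0 3
    have hadj := integral_mul_prodAddDeriv_sub L (contDiff_deriv_cutoff_mul_fundSol (c :: L)) hG
      (deriv_cutoff_mul_eq_zero _) t
    have hzero : fundSol (c :: L) 0 = 0 := solveODE_zero _ _
    have e1 : ∫ u in (0 : ℝ)..3, cutoff u * fundSol (c :: L) u * prodAddDeriv (c :: L) G (t - u) =
        (∫ u in (0 : ℝ)..3, cutoff u * fundSol L u * prodAddDeriv L G (t - u)) +
          c * ∫ u in (0 : ℝ)..3, (deriv cutoff u * fundSol (c :: L) u) *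
            prodAddDeriv L G (t - u) := by
      simp only [prodAddDeriv]
      rw [h, hzero, cutoff_of_two_le (show (2 : ℝ) ≤ 3 by norm_num),
        ← intervalIntegral.integral_const_mul, ← intervalIntegral.integral_add]
      · simp only [mul_zero, zero_mul, sub_zero, zero_add]
        refine intervalIntegral.integral_congr fun u _ => ?_
        rw [addDeriv_cutoff_mul c hE', addDeriv_fundSol hc]
        ring
      · exact ((contDiff_cutoff.continuous.mul hE.continuous).mul hPt).intervalIntegrable _ _
      · exact (continuous_const.mul ((hκ.mul hE'.continuous).mul hPt)).intervalIntegrable _ _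
    have e2 : ∫ u in (0 : ℝ)..3, truncSum (c :: L) u * G (t - u) =
        (∫ u in (0 : ℝ)..3, truncSum L u * G (t - u)) -
          c * ∫ u in (0 : ℝ)..3, prodAddDeriv' L
            (fun s => deriv cutoff s * fundSol (c :: L) s) u * G (t - u) := by
      rw [← intervalIntegral.integral_const_mul, ← intervalIntegral.integral_sub]
      · refine intervalIntegral.integral_congr fun u _ => ?_
        simp only [truncSum, truncTerm]
        ring
      · exact ((contDiff_truncSum L).continuous.mul hGt).intervalIntegrable _ _
      · exact (continuous_const.mul ((contDiff_prodAddDeriv' L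
          (contDiff_deriv_cutoff_mul_fundSol (c :: L))).continuous.mul hGt)).intervalIntegrable _ _
    rw [e1, e2, hadj, ih fun d hd => hL d (by simp [hd])]
    ring

end FundSol

section Limits

theorem le_add_two_of_le_add_geometric {x : ℕ → ℝ} (h : ∀ n, x (n + 1) ≤ x n + (1 / 2) ^ n)
    (n : ℕ) : x n ≤ x 0 + 2 := by
  have : x n ≤ x 0 + 2 - 2 * (1 / 2) ^ n := by
    induction n with
    | zero => simp
    | succ n ih => have := h n; rw [pow_succ]; linarith
  have : (0 : ℝ) < (1 / 2) ^ n := by positivity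
  linarith

theorem exists_tendstoUniformly_of_geometric {f : ℕ → ℝ → ℝ} {C : ℝ} {N : ℕ}
    (h : ∀ n, N ≤ n → ∀ x, |f (n + 1) x - f n x| ≤ C * (1 / 2) ^ n) :
    ∃ g, TendstoUniformly f g atTop := by
  have h' : ∀ x n, dist (f (n + N) x) (f (n + 1 + N) x) ≤ C * (1 / 2) ^ N * (1 / 2) ^ n := by
    intro x n
    rw [dist_comm, Real.dist_eq, add_right_comm]
    refine (h (n + N) (by omega) x).trans (le_of_eq ?_)
    rw [pow_add]; ring
  have hlim : ∀ x, ∃ a, Tendsto (fun n => f (n + N) x) atTop (𝓝 a) := fun x =>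
    cauchySeq_tendsto_of_complete (cauchySeq_of_le_geometric _ _ (by norm_num) (h' x))
  choose g hg using hlim
  refine ⟨g, Metric.tendstoUniformly_iff.2 fun ε hε => ?_⟩
  have hsmall : Tendsto (fun n : ℕ => C * (1 / 2 : ℝ) ^ N * (1 / 2) ^ n / (1 - 1 / 2)) atTop
      (𝓝 0) := by
    have := ((tendsto_pow_atTop_nhds_zero_of_lt_one (r := (1 / 2 : ℝ)) (by norm_num)
      (by norm_num)).const_mul (C * (1 / 2 : ℝ) ^ N)).div_const (1 - 1 / 2)
    simpa using this
  obtain ⟨m, hm⟩ := eventually_atTop.1 (hsmall.eventually_lt_const hε)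
  filter_upwards [eventually_ge_atTop (m + N)] with n hn x
  obtain ⟨j, rfl⟩ := Nat.exists_eq_add_of_le' (show N ≤ n by omega)
  rw [dist_comm]
  exact (dist_le_of_le_geometric_of_tendsto _ _ (by norm_num) (h' x) (hg x) j).trans_lt
    (hm j (by omega))

theorem integrable_of_tendsto_of_integral_abs_le {f : ℕ → ℝ → ℝ} {g : ℝ → ℝ} {C : ℝ}
    (hf : ∀ n, Integrable (f n)) (hC : ∀ n, ∫ x, |f n x| ≤ C)
    (hlim : ∀ x, Tendsto (fun n => f n x) atTop (𝓝 (g x))) : Integrable g := by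
  have hm : AEStronglyMeasurable g :=
    aestronglyMeasurable_of_tendsto_ae atTop (fun n => (hf n).1) (.of_forall hlim)
  rw [← memLp_one_iff_integrable]
  refine ⟨hm, ?_⟩
  refine (Lp.eLpNorm_lim_le_liminf_eLpNorm (fun n => (hf n).1) g (.of_forall hlim)).trans_lt ?_
  refine lt_of_le_of_lt (b := ENNReal.ofReal C) ?_ ENNReal.ofReal_lt_top
  refine liminf_le_of_frequently_le' (Frequently.of_forall fun n => ?_)
  rw [eLpNorm_one_eq_lintegral_enorm, ← ofReal_integral_norm_eq_lintegral_enorm (hf n)]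
  exact ENNReal.ofReal_le_ofReal (hC n)

theorem exists_bound_of_integrable_deriv {f : ℝ → ℝ} (hf : ContDiff ℝ (⊤ : ℕ∞) f)
    (hint : Integrable (deriv f)) : ∃ M, ∀ t, |f t| ≤ M := by
  refine ⟨|f 0| + ∫ s, |deriv f s|, fun t => ?_⟩
  have h := intervalIntegral.integral_deriv_eq_sub (f := f) (a := 0) (b := t)
    (fun x _ => (hf.hasDerivAt_of_top x).differentiableAt) hint.intervalIntegrable
  have h1 : |∫ s in (0 : ℝ)..t, deriv f s| ≤ ∫ s, |deriv f s| := by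
    refine (intervalIntegral.norm_integral_le_integral_norm_uIoc (f := deriv f)).trans ?_
    exact setIntegral_le_integral hint.norm (.of_forall fun _ => norm_nonneg _)
  have e : f t = f 0 + ∫ s in (0 : ℝ)..t, deriv f s := by rw [h]; ring
  rw [e]
  exact (abs_add_le _ _).trans (add_le_add_right h1 _)

end Limits

section Selection

variable {G : ℝ → ℝ}

theorem integrable_deriv_prodAddDeriv (L : List ℝ) (hG : ContDiff ℝ (⊤ : ℕ∞) G)
    (hint : ∀ k, Integrable (iteratedDeriv k G)) (k : ℕ) :
    Integrable (iteratedDeriv k (deriv (prodAddDeriv L G))) := by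
  rw [← iteratedDeriv_succ']
  exact integrable_iteratedDeriv_prodAddDeriv L hG hint (k + 1)

/-- A parameter small enough that adjoining it changes every relevant quantity by at most
`2 ^ (-L.length)`. -/
theorem exists_small_parameter (hG : ContDiff ℝ (⊤ : ℕ∞) G)
    (hint : ∀ k, Integrable (iteratedDeriv k G)) {L : List ℝ} (hL : ∀ c ∈ L, 0 < c) :
    ∃ c, 0 < c ∧ c ≤ (1 / 2) ^ L.length ∧
      (∀ u, |c * deriv (prodAddDeriv L G) u| ≤ (1 / 2) ^ L.length) ∧
      (∫ u, |c * deriv (prodAddDeriv L G) u| ≤ (1 / 2) ^ L.length) ∧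
      ∀ k ≤ L.length, ∀ u, |iteratedDeriv k (truncTerm (c :: L)) u| ≤ (1 / 2) ^ L.length := by
  have hP := contDiff_prodAddDeriv L hG
  have hi := integrable_deriv_prodAddDeriv L hG hint
  obtain ⟨M, hM⟩ := exists_bound_of_integrable_deriv hP.deriv_of_top
    (by simpa using hi 1)
  choose B hB using exists_uniform_bound_iteratedDeriv_deriv_cutoff_mul hL
  choose C hC using fun k => exists_bound_iteratedDeriv_prodAddDeriv' L k B
  set I := ∫ u, |deriv (prodAddDeriv L G) u| with hI
  have hI0 : 0 ≤ I := integral_nonneg fun _ => abs_nonneg _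
  have hM0 : 0 ≤ M := (abs_nonneg _).trans (hM 0)
  set T := ∑ k ∈ Finset.range (L.length + 1), |C k| with hT
  have hT0 : 0 ≤ T := Finset.sum_nonneg fun _ _ => abs_nonneg _
  have hS : 0 < 1 + M + I + T := by positivity
  set q : ℝ := (1 / 2) ^ L.length with hq
  have hq0 : 0 < q := by positivity
  have hq1 : q ≤ 1 := pow_le_one₀ (by norm_num) (by norm_num)
  have hc0 : 0 < q / (1 + M + I + T) := by positivity
  have hmul : ∀ x, x ≤ 1 + M + I + T → q / (1 + M + I + T) * x ≤ q := fun x hx => by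
    rw [div_mul_eq_mul_div, div_le_iff₀ hS]
    exact mul_le_mul_of_nonneg_left hx hq0.le
  have hcq : q / (1 + M + I + T) ≤ q := by simpa using hmul 1 (by linarith)
  refine ⟨q / (1 + M + I + T), hc0, hcq, fun u => ?_, ?_, fun k hk u => ?_⟩
  · rw [abs_mul, abs_of_pos hc0]
    exact hmul _ ((hM u).trans (by linarith))
  · simp_rw [abs_mul, abs_of_pos hc0]
    rw [integral_const_mul]
    exact hmul _ (by linarith)
  · have e : iteratedDeriv k (truncTerm (q / (1 + M + I + T) :: L)) u =
        -(q / (1 + M + I + T)) * iteratedDeriv k (prodAddDeriv' L fun s =>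
          deriv cutoff s * fundSol (q / (1 + M + I + T) :: L) s) u := by
      rw [← iteratedDeriv_const_mul_field]
      congr 1
      funext t
      simp [truncTerm]
    rw [e, abs_mul, abs_neg, abs_of_pos hc0]
    refine hmul _ ((hC k _ (contDiff_deriv_cutoff_mul_fundSol _)
      (fun j t => hB j _ hc0 (hcq.trans hq1) t) u).trans ?_)
    have h1 : |C k| ≤ T :=
      Finset.single_le_sum (f := fun k => |C k|) (fun _ _ => abs_nonneg _)
        (Finset.mem_range.2 (by omega))
    linarith [le_abs_self (C k)]

/-- A nested sequence of parameter lists along which all relevant quantities converge. -/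
theorem exists_parameter_sequence (hG : ContDiff ℝ (⊤ : ℕ∞) G)
    (hint : ∀ k, Integrable (iteratedDeriv k G)) :
    ∃ (c : ℕ → ℝ) (L : ℕ → List ℝ), L 0 = [] ∧ (∀ n, L (n + 1) = c n :: L n) ∧
      (∀ n, (L n).length = n) ∧ (∀ n, ∀ d ∈ L n, 0 < d) ∧
      ∀ n, 0 < c n ∧ c n ≤ (1 / 2) ^ n ∧
        (∀ u, |c n * deriv (prodAddDeriv (L n) G) u| ≤ (1 / 2) ^ n) ∧
        (∫ u, |c n * deriv (prodAddDeriv (L n) G) u| ≤ (1 / 2) ^ n) ∧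
        ∀ k ≤ n, ∀ u, |iteratedDeriv k (truncTerm (L (n + 1))) u| ≤ (1 / 2) ^ n := by
  choose! next hnext using fun L : List ℝ => exists_small_parameter hG hint (L := L)
  let L : ℕ → List ℝ := fun n => Nat.rec [] (fun _ l => next l :: l) n
  have hsucc : ∀ n, L (n + 1) = next (L n) :: L n := fun n => rfl
  have hlen : ∀ n, (L n).length = n := by
    intro n
    induction n with
    | zero => rfl
    | succ n ih => rw [hsucc, List.length_cons, ih]
  have hpos : ∀ n, ∀ d ∈ L n, 0 < d := by
    intro n
    induction n with
    | zero => intro d hd; simp [L] at hd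
    | succ n ih =>
      intro d hd
      rw [hsucc, List.mem_cons] at hd
      rcases hd with rfl | hd
      · exact (hnext _ ih).1
      · exact ih d hd
  refine ⟨fun n => next (L n), L, rfl, hsucc, hlen, hpos, fun n => ?_⟩
  have h := hnext (L n) (hpos n)
  rw [hlen] at h
  exact h

end Selection

section Additive

variable {G : ℝ → ℝ}

/-- The limit of the fundamental solutions, extended by zero to the left, is smooth. -/
theorem exists_limit_fundSol {c : ℕ → ℝ} {L : ℕ → List ℝ}
    (hL : ∀ n, L (n + 1) = c n :: L n) (hlen : ∀ n, (L n).length = n)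
    (hpos : ∀ n, ∀ d ∈ L n, 0 < d) (hc : ∀ n, 0 < c n) (hc' : ∀ n, c n ≤ (1 / 2) ^ n) :
    ∃ E : ℝ → ℝ, ContDiff ℝ (⊤ : ℕ∞) E ∧ (∀ u ≤ 0, E u = 0) ∧
      (∀ u, 0 < u → Tendsto (fun n => fundSol (L n) u) atTop (𝓝 (E u))) ∧
      ∃ M, ∀ n u, 0 ≤ u → |fundSol (L n) u| ≤ M := by
  have hbound : ∀ k, ∃ M, ∀ n, k ≤ n → ∀ u, 0 ≤ u → |iteratedDeriv k (fundSol (L n)) u| ≤ M := by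
    intro k
    obtain ⟨M, hM⟩ := exists_bound_iteratedDeriv_fundSol (hpos k) k
    refine ⟨M, fun n hn => ?_⟩
    induction n, hn using Nat.le_induction with
    | base => exact hM
    | succ n hn ih =>
      intro u hu
      have h := abs_iteratedDeriv_fundSol_le (hc n) ih hu
      rw [← hL, iteratedDeriv_fundSol_zero (hpos (n + 1)) (by rw [hlen]; omega)] at h
      simpa using h
  choose M hM using hbound
  let f : ℕ → ℕ → ℝ → ℝ := fun k n => (Set.Ioi 0).indicator (iteratedDeriv k (fundSol (L n)))
  have hstep : ∀ k n, k ≤ n → ∀ u, |f k (n + 1) u - f k n u| ≤ M (k + 1) * (1 / 2) ^ n := by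
    intro k n hn u
    have hM0 : 0 ≤ M (k + 1) := (abs_nonneg _).trans (hM (k + 1) (k + 1) le_rfl 0 le_rfl)
    by_cases hu : 0 < u
    · have h := iteratedDeriv_fundSol_add (hc n) (L n) k u
      rw [← hL] at h
      have e : f k (n + 1) u - f k n u =
          -(c n * iteratedDeriv (k + 1) (fundSol (L (n + 1))) u) := by
        simp only [f, Set.indicator_of_mem (Set.mem_Ioi.2 hu)]
        linarith
      rw [e, abs_neg, abs_mul, abs_of_pos (hc n), mul_comm]
      exact mul_le_mul (hM (k + 1) (n + 1) (by omega) u hu.le) (hc' n) (hc n).le hM0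
    · have hu' : u ∉ Set.Ioi (0 : ℝ) := by simpa using hu
      simp only [f, Set.indicator_of_notMem hu', sub_self, abs_zero]
      positivity
  choose g hg using fun k => exists_tendstoUniformly_of_geometric (hstep k)
  have hderiv : ∀ k u, HasDerivAt (g k) (g (k + 1) u) u := by
    intro k
    refine hasDerivAt_of_tendstoUniformly (hg (k + 1)) ?_ fun x => (hg k).tendsto_at x
    filter_upwards [eventually_ge_atTop (k + 2)] with n hn
    exact HasDerivAt.indicator_Ioi (fun t => (contDiff_fundSol (L n)).hasDerivAt_iteratedDeriv k t)
      (iteratedDeriv_fundSol_zero (hpos n) (by rw [hlen]; omega))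
      (iteratedDeriv_fundSol_zero (hpos n) (by rw [hlen]; omega))
  refine ⟨g 0, contDiff_top_of_hasDerivAt_chain hderiv, fun u hu => ?_, fun u hu => ?_, M 0,
    fun n u hu => by simpa using hM 0 n (Nat.zero_le n) u hu⟩
  · have hu' : u ∉ Set.Ioi (0 : ℝ) := by simpa using hu
    refine tendsto_nhds_unique ((hg 0).tendsto_at u) ?_
    simp only [f, Set.indicator_of_notMem hu']
    exact tendsto_const_nhds
  · have h := (hg 0).tendsto_at u
    simpa only [f, Set.indicator_of_mem (Set.mem_Ioi.2 hu), iteratedDeriv_zero] using h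

/-- The total truncation errors converge to a smooth function. -/
theorem exists_limit_truncSum {c : ℕ → ℝ} {L : ℕ → List ℝ} (hL0 : L 0 = [])
    (hL : ∀ n, L (n + 1) = c n :: L n)
    (hb : ∀ n, ∀ k ≤ n, ∀ u, |iteratedDeriv k (truncTerm (L (n + 1))) u| ≤ (1 / 2) ^ n) :
    ∃ θ : ℝ → ℝ, ContDiff ℝ (⊤ : ℕ∞) θ ∧ (∀ u ∉ Set.Icc (1 : ℝ) 2, θ u = 0) ∧
      (∀ u, Tendsto (fun n => truncSum (L n) u) atTop (𝓝 (θ u))) ∧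
      ∃ M, ∀ n u, |truncSum (L n) u| ≤ M := by
  have hsucc : ∀ n u, truncSum (L (n + 1)) u = truncSum (L n) u + truncTerm (L (n + 1)) u := by
    intro n u
    rw [hL]; rfl
  have hsum : ∀ n u, truncSum (L n) u = ∑ i ∈ Finset.range (n + 1), truncTerm (L i) u := by
    intro n u
    induction n with
    | zero => simp [hL0, truncSum]
    | succ n ih => rw [hsucc, ih, Finset.sum_range_succ _ (n + 1)]
  have hgeo : Summable fun n : ℕ => (1 / 2 : ℝ) ^ n := summable_geometric_two
  have hs : ∀ u, Summable fun i => truncTerm (L i) u := by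
    intro u
    rw [← summable_nat_add_iff 1]
    exact Summable.of_norm_bounded hgeo fun n => by
      simpa using hb n 0 (Nat.zero_le n) u
  refine ⟨fun u => ∑' i, truncTerm (L i) u, ?_, fun u hu => ?_, fun u => ?_, ?_⟩
  · refine contDiff_tsum_of_eventually (v := fun _ n => 2 * (1 / 2 : ℝ) ^ n)
      (fun i => contDiff_truncTerm (L i)) (fun _ _ => hgeo.mul_left 2) fun k _ => ?_
    rw [Nat.cofinite_eq_atTop]
    filter_upwards [eventually_ge_atTop (k + 1)] with n hn u
    obtain ⟨j, rfl⟩ := Nat.exists_eq_add_of_le' (show 1 ≤ n by omega)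
    rw [norm_iteratedFDeriv_eq_norm_iteratedDeriv, pow_succ]
    have := hb j k (by omega) u
    rw [Real.norm_eq_abs]
    linarith
  · simp [truncTerm_eq_zero _ u hu]
  · simp_rw [hsum]
    exact ((hs u).hasSum.tendsto_sum_nat).comp (tendsto_add_atTop_nat 1)
  · obtain ⟨K, hK⟩ := exists_bound_of_vanish (contDiff_truncSum (L 0)).continuous
      (truncSum_eq_zero (L 0))
    refine ⟨K + 2, fun n u => ?_⟩
    refine (le_add_two_of_le_add_geometric (x := fun n => |truncSum (L n) u|) (fun n => ?_) n).trans
      (by linarith [hK u])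
    simp only [hsucc]
    exact (abs_add_le _ _).trans
      (add_le_add_right (by simpa using hb n 0 (Nat.zero_le n) u) _)

/-- The images of a smooth `L¹` function under the operators converge to an `L¹` function. -/
theorem exists_limit_prodAddDeriv (hG : ContDiff ℝ (⊤ : ℕ∞) G)
    (hint : ∀ k, Integrable (iteratedDeriv k G)) {c : ℕ → ℝ} {L : ℕ → List ℝ}
    (hL : ∀ n, L (n + 1) = c n :: L n)
    (hb : ∀ n u, |c n * deriv (prodAddDeriv (L n) G) u| ≤ (1 / 2) ^ n)
    (hbi : ∀ n, ∫ u, |c n * deriv (prodAddDeriv (L n) G) u| ≤ (1 / 2) ^ n) :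
    ∃ g : ℝ → ℝ, Integrable g ∧
      (∀ u, Tendsto (fun n => prodAddDeriv (L n) G u) atTop (𝓝 (g u))) ∧
      ∃ M, ∀ n u, |prodAddDeriv (L n) G u| ≤ M := by
  have hsucc : ∀ n u, prodAddDeriv (L (n + 1)) G u =
      prodAddDeriv (L n) G u + c n * deriv (prodAddDeriv (L n) G) u := by
    intro n u
    rw [hL]; rfl
  have hi : ∀ n, Integrable (prodAddDeriv (L n) G) := fun n => by
    simpa using integrable_iteratedDeriv_prodAddDeriv (L n) hG hint 0
  have hi' : ∀ n, Integrable (deriv (prodAddDeriv (L n) G)) := fun n => by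
    simpa using integrable_deriv_prodAddDeriv (L n) hG hint 0
  obtain ⟨g, hg⟩ := exists_tendstoUniformly_of_geometric
    (f := fun n => prodAddDeriv (L n) G) (C := 1) (N := 0) fun n _ u => by
      rw [hsucc, add_sub_cancel_left, one_mul]
      exact hb n u
  refine ⟨g, ?_, fun u => hg.tendsto_at u, ?_⟩
  · refine integrable_of_tendsto_of_integral_abs_le hi
      (fun n => le_add_two_of_le_add_geometric
        (x := fun n => ∫ u, |prodAddDeriv (L n) G u|) (fun n => ?_) n)
      fun u => hg.tendsto_at u
    refine le_trans ?_ (add_le_add_right (hbi n) _)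
    rw [← integral_add (hi n).abs ((hi' n).const_mul (c n)).abs]
    refine integral_mono (hi (n + 1)).abs ((hi n).abs.add ((hi' n).const_mul (c n)).abs) fun u => ?_
    simp only [hsucc]
    exact abs_add_le _ _
  · obtain ⟨K, hK⟩ := exists_bound_of_integrable_deriv (contDiff_prodAddDeriv (L 0) hG) (hi' 0)
    refine ⟨K + 2, fun n u => ?_⟩
    refine (le_add_two_of_le_add_geometric (x := fun n => |prodAddDeriv (L n) G u|)
      (fun n => ?_) n).trans (by linarith [hK u])
    simp only [hsucc]
    exact (abs_add_le _ _).trans (add_le_add_right (hb n u) _)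

theorem integral_eq_intervalIntegral_of_vanish {f : ℝ → ℝ}
    (hf : ∀ u ∉ Set.Ioc (0 : ℝ) 3, f u = 0) : ∫ u, f u = ∫ u in (0 : ℝ)..3, f u := by
  rw [intervalIntegral.integral_of_le (by norm_num),
    setIntegral_eq_integral_of_forall_compl_eq_zero hf]

/-- Weak Dixmier–Malliavin factorization on `ℝ`. -/
theorem exists_convolution_factorization (hG : ContDiff ℝ (⊤ : ℕ∞) G)
    (hint : ∀ k, Integrable (iteratedDeriv k G)) :
    ∃ θ₁ θ₂ g : ℝ → ℝ, ContDiff ℝ (⊤ : ℕ∞) θ₁ ∧ ContDiff ℝ (⊤ : ℕ∞) θ₂ ∧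
      (∀ u ∉ Set.Icc (0 : ℝ) 2, θ₁ u = 0) ∧ (∀ u ∉ Set.Icc (0 : ℝ) 2, θ₂ u = 0) ∧
      Integrable g ∧ ∀ t, G t = ∫ s, (θ₁ (t - s) * g s + θ₂ (t - s) * G s) := by
  obtain ⟨c, L, hL0, hL, hlen, hpos, hc⟩ := exists_parameter_sequence hG hint
  obtain ⟨E, hE, hE0, hElim, ME, hME⟩ := exists_limit_fundSol hL hlen hpos
    (fun n => (hc n).1) fun n => (hc n).2.1
  obtain ⟨θ, hθ, hθ0, hθlim, Mθ, hMθ⟩ := exists_limit_truncSum hL0 hL fun n => (hc n).2.2.2.2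
  obtain ⟨g, hg, hglim, Mg, hMg⟩ := exists_limit_prodAddDeriv hG hint hL
    (fun n => (hc n).2.2.1) fun n => (hc n).2.2.2.1
  have hG0 : Integrable G := by simpa using hint 0
  obtain ⟨MG, hMG⟩ := exists_bound_of_integrable_deriv hG (by simpa using hint 1)
  have hθ₁ : ContDiff ℝ (⊤ : ℕ∞) fun u => cutoff u * E u := contDiff_cutoff.mul hE
  have hv₁ : ∀ u ∉ Set.Ioc (0 : ℝ) 2, cutoff u * E u = 0 := by
    intro u hu
    rcases le_or_gt u 0 with h | h
    · rw [hE0 u h, mul_zero]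
    · rw [cutoff_of_two_le (by by_contra! h2; exact hu ⟨h, h2.le⟩), zero_mul]
  have hv₁' : ∀ u ∉ Set.Icc (0 : ℝ) 2, cutoff u * E u = 0 := fun u hu =>
    hv₁ u fun h => hu (Set.Ioc_subset_Icc_self h)
  have hv₂' : ∀ u ∉ Set.Icc (0 : ℝ) 2, θ u = 0 := fun u hu =>
    hθ0 u fun h => hu (Set.Icc_subset_Icc_left zero_le_one h)
  refine ⟨fun u => cutoff u * E u, θ, g, hθ₁, hθ, hv₁', hv₂', hg, fun t => ?_⟩
  have lim₁ : Tendsto (fun n => ∫ u in (0 : ℝ)..3,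
      cutoff u * fundSol (L n) u * prodAddDeriv (L n) G (t - u)) atTop
      (𝓝 (∫ u in (0 : ℝ)..3, cutoff u * E u * g (t - u))) := by
    refine intervalIntegral.tendsto_integral_filter_of_dominated_convergence (fun _ => 1 * ME * Mg)
      (.of_forall fun n => ?_) (.of_forall fun n => .of_forall fun u hu => ?_)
      intervalIntegrable_const (.of_forall fun u hu => ?_)
    · exact ((contDiff_cutoff.continuous.mul (contDiff_fundSol (L n)).continuous).mul
        ((contDiff_prodAddDeriv (L n) hG).continuous.comp (by fun_prop))).aestronglyMeasurable
    · rw [Set.uIoc_of_le (by norm_num)] at hu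
      have hME0 : 0 ≤ ME := (abs_nonneg _).trans (hME n u hu.1.le)
      rw [Real.norm_eq_abs, abs_mul, abs_mul]
      exact mul_le_mul (mul_le_mul (abs_cutoff_le_one u) (hME n u hu.1.le) (abs_nonneg _)
        zero_le_one) (hMg n _) (abs_nonneg _) (by positivity)
    · rw [Set.uIoc_of_le (by norm_num)] at hu
      exact (tendsto_const_nhds.mul (hElim u hu.1)).mul (hglim (t - u))
  have lim₂ : Tendsto (fun n => ∫ u in (0 : ℝ)..3, truncSum (L n) u * G (t - u)) atTop
      (𝓝 (∫ u in (0 : ℝ)..3, θ u * G (t - u))) := by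
    refine intervalIntegral.tendsto_integral_filter_of_dominated_convergence (fun _ => Mθ * MG)
      (.of_forall fun n => ?_) (.of_forall fun n => .of_forall fun u hu => ?_)
      intervalIntegrable_const (.of_forall fun u hu => ?_)
    · exact ((contDiff_truncSum (L n)).continuous.mul
        (hG.continuous.comp (by fun_prop))).aestronglyMeasurable
    · have hMθ0 : 0 ≤ Mθ := (abs_nonneg _).trans (hMθ n u)
      rw [Real.norm_eq_abs, abs_mul]
      exact mul_le_mul (hMθ n u) (hMG _) (abs_nonneg _) hMθ0
    · exact (hθlim u).mul tendsto_const_nhds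
  have key : G t = (∫ u in (0 : ℝ)..3, cutoff u * E u * g (t - u)) +
      ∫ u in (0 : ℝ)..3, θ u * G (t - u) := by
    refine tendsto_nhds_unique ?_ (lim₁.add lim₂)
    simp_rw [← eq_integral_fundSol_add_truncSum (hpos _) hG t]
    exact tendsto_const_nhds
  have i₁ : Integrable fun u => cutoff u * E u * g (t - u) := by
    obtain ⟨B, hB⟩ := exists_bound_of_vanish hθ₁.continuous hv₁'
    exact (hg.comp_sub_left t).bdd_mul hθ₁.continuous.aestronglyMeasurable (.of_forall hB)
  have i₂ : Integrable fun u => θ u * G (t - u) := by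
    obtain ⟨B, hB⟩ := exists_bound_of_vanish hθ.continuous hv₂'
    exact (hG0.comp_sub_left t).bdd_mul hθ.continuous.aestronglyMeasurable (.of_forall hB)
  have hsub := integral_sub_left_eq_self
    (fun s => cutoff (t - s) * E (t - s) * g s + θ (t - s) * G s) volume t
  simp only [sub_sub_cancel] at hsub
  rw [← hsub, integral_add i₁ i₂, integral_eq_intervalIntegral_of_vanish,
    integral_eq_intervalIntegral_of_vanish, key]
  · intro u hu
    rw [hθ0 u fun h => hu ⟨by linarith [h.1], by linarith [h.2]⟩, zero_mul]
  · intro u hu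
    rw [hv₁ u fun h => hu ⟨h.1, by linarith [h.2]⟩, zero_mul]

end Additive

section Exponential

variable {F : ℝ → ℝ}

/-- The function `x ^ j * F^{(j)} x` in the logarithmic variable. -/
noncomputable def logPowDeriv (F : ℝ → ℝ) (j : ℕ) (t : ℝ) : ℝ :=
  Real.exp (j * t) * iteratedDerivWithin j F (Set.Ioi 0) (Real.exp t)

theorem hasDerivAt_logPowDeriv (hF : ContDiffOn ℝ (⊤ : ℕ∞) F (Set.Ioi 0)) (j : ℕ) (t : ℝ) :
    HasDerivAt (logPowDeriv F j) (j * logPowDeriv F j t + logPowDeriv F (j + 1) t) t := by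
  have hx : Real.exp t ∈ Set.Ioi (0 : ℝ) := Real.exp_pos t
  have h1 : HasDerivAt (iteratedDerivWithin j F (Set.Ioi 0))
      (iteratedDerivWithin (j + 1) F (Set.Ioi 0) (Real.exp t)) (Real.exp t) := by
    have hd := (hF.differentiableOn_iteratedDerivWithin (m := j)
      (by exact_mod_cast ENat.natCast_lt_top j) (uniqueDiffOn_Ioi 0)).differentiableAt
      (isOpen_Ioi.mem_nhds hx)
    rw [iteratedDerivWithin_succ, derivWithin_of_isOpen isOpen_Ioi hx]
    exact hd.hasDerivAt
  have h2 : HasDerivAt (fun t : ℝ => Real.exp (j * t)) (Real.exp (j * t) * j) t := by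
    simpa using ((hasDerivAt_id t).const_mul (j : ℝ)).exp
  refine (h2.mul (h1.comp t (Real.hasDerivAt_exp t))).congr_deriv ?_
  have e : Real.exp (((j + 1 : ℕ) : ℝ) * t) = Real.exp (j * t) * Real.exp t := by
    rw [← Real.exp_add]; push_cast; ring_nf
  simp only [logPowDeriv, e, Function.comp]
  ring

theorem contDiff_logPowDeriv (hF : ContDiffOn ℝ (⊤ : ℕ∞) F (Set.Ioi 0)) (j : ℕ) :
    ContDiff ℝ (⊤ : ℕ∞) (logPowDeriv F j) := by
  refine contDiff_infty.2 fun n => ?_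
  induction n generalizing j with
  | zero =>
    exact contDiff_zero.2 (continuous_iff_continuousAt.2 fun t =>
      (hasDerivAt_logPowDeriv hF j t).continuousAt)
  | succ n ih =>
    push_cast
    refine contDiff_succ_iff_deriv.2
      ⟨fun t => (hasDerivAt_logPowDeriv hF j t).differentiableAt, by simp, ?_⟩
    rw [funext fun t => (hasDerivAt_logPowDeriv hF j t).deriv]
    exact (contDiff_const.mul (ih j)).add (ih (j + 1))

theorem image_exp_univ : Real.exp '' Set.univ = Set.Ioi 0 := by
  rw [Set.image_univ, Real.range_exp]

theorem integrableOn_Ioi_iff_integrable_exp (h : ℝ → ℝ) :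
    IntegrableOn h (Set.Ioi 0) ↔ Integrable fun t => Real.exp t * h (Real.exp t) := by
  rw [← image_exp_univ, integrableOn_image_iff_integrableOn_abs_deriv_smul MeasurableSet.univ
    (fun t _ => (Real.hasDerivAt_exp t).hasDerivWithinAt) Real.exp_injective.injOn,
    integrableOn_univ]
  simp

theorem integral_Ioi_eq_integral_exp (h : ℝ → ℝ) :
    ∫ x in Set.Ioi 0, h x = ∫ t, Real.exp t * h (Real.exp t) := by
  rw [← image_exp_univ, integral_image_eq_integral_abs_deriv_smul MeasurableSet.univ
    (fun t _ => (Real.hasDerivAt_exp t).hasDerivWithinAt) Real.exp_injective.injOn,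
    setIntegral_univ]
  simp

theorem integrable_logPowDeriv (hF : ContDiffOn ℝ (⊤ : ℕ∞) F (Set.Ioi 0)) {j : ℕ}
    (hint : IntegrableOn
      (fun x => x ^ ((j : ℝ) - 1) * |iteratedDerivWithin j F (Set.Ioi 0) x|) (Set.Ioi 0)) :
    Integrable (logPowDeriv F j) := by
  rw [integrableOn_Ioi_iff_integrable_exp] at hint
  rw [← integrable_norm_iff (contDiff_logPowDeriv hF j).continuous.aestronglyMeasurable]
  refine hint.congr (.of_forall fun t => ?_)
  have e : Real.exp t * Real.exp t ^ ((j : ℝ) - 1) = Real.exp (j * t) := by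
    rw [← Real.exp_mul, ← Real.exp_add]; ring_nf
  simp only [logPowDeriv, norm_mul, Real.norm_eq_abs, Real.abs_exp]
  rw [← mul_assoc, e]

theorem integrable_iteratedDeriv_logPowDeriv (hF : ContDiffOn ℝ (⊤ : ℕ∞) F (Set.Ioi 0))
    (hint : ∀ k : ℕ, IntegrableOn
      (fun x => x ^ ((k : ℝ) - 1) * |iteratedDerivWithin k F (Set.Ioi 0) x|) (Set.Ioi 0))
    (k j : ℕ) : Integrable (iteratedDeriv k (logPowDeriv F j)) := by
  induction k generalizing j with
  | zero => simpa using integrable_logPowDeriv hF (hint j)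
  | succ k ih =>
    have e : iteratedDeriv (k + 1) (logPowDeriv F j) = fun t =>
        j * iteratedDeriv k (logPowDeriv F j) t + iteratedDeriv k (logPowDeriv F (j + 1)) t := by
      funext t
      rw [iteratedDeriv_succ', funext fun t => (hasDerivAt_logPowDeriv hF j t).deriv,
        iteratedDeriv_fun_add, iteratedDeriv_const_mul_field]
      · exact ((contDiff_const.mul (contDiff_logPowDeriv hF j)).contDiff_nat_of_top k).contDiffAt
      · exact ((contDiff_logPowDeriv hF (j + 1)).contDiff_nat_of_top k).contDiffAt
    rw [e]
    exact ((ih j).const_mul _).add (ih (j + 1))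

/-- A function on `ℝ` transported to `(0,∞)` by the logarithm and extended by zero. -/
noncomputable def mulLift (θ : ℝ → ℝ) : ℝ → ℝ := (Set.Ioi 0).indicator fun x => θ (Real.log x)

variable {θ : ℝ → ℝ} {a b : ℝ}

theorem mulLift_eq_zero (hv : ∀ u ∉ Set.Icc a b, θ u = 0) :
    ∀ x ∉ Set.Icc (Real.exp a) (Real.exp b), mulLift θ x = 0 := by
  intro x hx
  by_cases h : 0 < x
  · rw [mulLift, Set.indicator_of_mem (Set.mem_Ioi.2 h)]
    refine hv _ fun hl => hx ⟨?_, ?_⟩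
    · exact (Real.le_log_iff_exp_le h).1 hl.1
    · exact (Real.log_le_iff_le_exp h).1 hl.2
  · exact Set.indicator_of_notMem (by simpa using h) _

theorem tsupport_mulLift_subset (hv : ∀ u ∉ Set.Icc a b, θ u = 0) :
    tsupport (mulLift θ) ⊆ Set.Icc (Real.exp a) (Real.exp b) :=
  closure_minimal (fun x hx => by
    by_contra h
    exact hx (mulLift_eq_zero hv x h)) isClosed_Icc

theorem hasCompactSupport_mulLift (hv : ∀ u ∉ Set.Icc a b, θ u = 0) :
    HasCompactSupport (mulLift θ) :=
  isCompact_Icc.of_isClosed_subset (isClosed_tsupport _) (tsupport_mulLift_subset hv)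

theorem tsupport_mulLift_subset_Ioi (hv : ∀ u ∉ Set.Icc a b, θ u = 0) :
    tsupport (mulLift θ) ⊆ Set.Ioi 0 := fun _ hx =>
  (Real.exp_pos a).trans_le (tsupport_mulLift_subset hv hx).1

theorem contDiff_mulLift (hθ : ContDiff ℝ (⊤ : ℕ∞) θ) (hv : ∀ u ∉ Set.Icc a b, θ u = 0) :
    ContDiff ℝ (⊤ : ℕ∞) (mulLift θ) := by
  refine contDiff_iff_contDiffAt.2 fun x => ?_
  rcases lt_or_ge x (Real.exp a) with h | h
  · refine (contDiffAt_const (c := (0 : ℝ))).congr_of_eventuallyEq ?_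
    filter_upwards [Iio_mem_nhds h] with y hy
    exact mulLift_eq_zero hv y fun hy' => absurd hy'.1 (not_le.2 hy)
  · have hx : 0 < x := (Real.exp_pos a).trans_le h
    refine (hθ.contDiffAt.comp x (Real.contDiffAt_log.2 hx.ne')).congr_of_eventuallyEq ?_
    filter_upwards [Ioi_mem_nhds hx] with y hy
    exact Set.indicator_of_mem hy _

theorem mulLift_exp_div (θ : ℝ → ℝ) (t s : ℝ) :
    mulLift θ (Real.exp t / Real.exp s) = θ (t - s) := by
  rw [← Real.exp_sub, mulLift, Set.indicator_of_mem (Set.mem_Ioi.2 (Real.exp_pos _)),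
    Real.log_exp]

theorem integrableOn_log_div {g : ℝ → ℝ} (hg : Integrable g) :
    IntegrableOn (fun y => g (Real.log y) / y) (Set.Ioi 0) := by
  rw [integrableOn_Ioi_iff_integrable_exp]
  refine hg.congr (.of_forall fun t => ?_)
  simp only [Real.log_exp]
  field_simp

end Exponential

/-- Multiplicative weak factorization on `(0,∞)`: if
`∫₀^∞ x^{k-1}|F^{(k)}(x)| dx < ∞` for all `k`, then
`F(x) = ∫₀^∞ Θ₁(x/y)F₁(y) + Θ₂(x/y)F₂(y) dy` with `Θᵢ ∈ C_c^∞(0,∞)`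
and `Fᵢ ∈ L¹(0,∞)`. -/
theorem multiplicative_weak_factorization (F : ℝ → ℝ)
    (hF : ContDiffOn ℝ (⊤ : ℕ∞) F (Set.Ioi 0))
    (hint : ∀ k : ℕ, IntegrableOn
      (fun x => x ^ ((k : ℝ) - 1) * |iteratedDerivWithin k F (Set.Ioi 0) x|)
      (Set.Ioi 0)) :
    ∃ (Θ₁ Θ₂ F₁ F₂ : ℝ → ℝ),
      ContDiff ℝ (⊤ : ℕ∞) Θ₁ ∧ HasCompactSupport Θ₁ ∧ tsupport Θ₁ ⊆ Set.Ioi 0 ∧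
      ContDiff ℝ (⊤ : ℕ∞) Θ₂ ∧ HasCompactSupport Θ₂ ∧ tsupport Θ₂ ⊆ Set.Ioi 0 ∧
      IntegrableOn F₁ (Set.Ioi 0) ∧ IntegrableOn F₂ (Set.Ioi 0) ∧
      ∀ x : ℝ, 0 < x →
        F x = ∫ y in Set.Ioi (0:ℝ), (Θ₁ (x / y) * F₁ y + Θ₂ (x / y) * F₂ y) := by
  have hG : ContDiff ℝ (⊤ : ℕ∞) (logPowDeriv F 0) := contDiff_logPowDeriv hF 0
  have hGint : ∀ k, Integrable (iteratedDeriv k (logPowDeriv F 0)) := fun k =>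
    integrable_iteratedDeriv_logPowDeriv hF hint k 0
  obtain ⟨θ₁, θ₂, g, h₁, h₂, hv₁, hv₂, hg, hfac⟩ := exists_convolution_factorization hG hGint
  have hG0 : Integrable (logPowDeriv F 0) := by simpa using hGint 0
  refine ⟨mulLift θ₁, mulLift θ₂, fun y => g (Real.log y) / y,
    fun y => logPowDeriv F 0 (Real.log y) / y, contDiff_mulLift h₁ hv₁,
    hasCompactSupport_mulLift hv₁, tsupport_mulLift_subset_Ioi hv₁, contDiff_mulLift h₂ hv₂,
    hasCompactSupport_mulLift hv₂, tsupport_mulLift_subset_Ioi hv₂, integrableOn_log_div hg,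
    integrableOn_log_div hG0, fun x hx => ?_⟩
  obtain ⟨t, rfl⟩ : ∃ t, Real.exp t = x := ⟨Real.log x, Real.exp_log hx⟩
  have e : F (Real.exp t) = logPowDeriv F 0 t := by simp [logPowDeriv]
  rw [integral_Ioi_eq_integral_exp, e, hfac t]
  refine integral_congr_ae (.of_forall fun s => ?_)
  simp only [mulLift_exp_div, Real.log_exp]
  field_simp
end
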